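/- arXiv:1109.4381 — 13 statements merged into one kernel-verified Lean document; each statement's English description precedes it below -/
import Mathlib

section
/- Let u, X ∈ K with v(u) > 0, X ≠ 0 and X^{q²} + u X^q + π X = 0. Then: (1) if v(X) > 1/(q²−1), then v(X) = (1−v(u))/(q−1) and v(u) < q/(q+1); (2) if v(X) = 1/(q²−1), then v(u) ≥ q/(q+1); (3) if v(X) < 1/(q²−1), then v(X) = v(u)/(q(q−1)) and v(u) < q/(q+1). -/
/-- The value of `1` under a valuation into `WithTop ℝ` is `0`. -/
theorem valuation_one {K : Type*} [Field K] (v : K → WithTop ℝ)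
    (hv_top : ∀ x : K, v x = ⊤ ↔ x = 0)
    (hv_mul : ∀ x y : K, v (x * y) = v x + v y) : v 1 = 0 := by
  have h := hv_mul 1 1
  obtain ⟨a, ha⟩ := WithTop.ne_top_iff_exists.mp (fun h => one_ne_zero ((hv_top 1).mp h))
  rw [mul_one, ← ha] at h
  rw [← ha]
  norm_cast at h ⊢
  linarith

theorem valuation_neg {K : Type*} [Field K] (v : K → WithTop ℝ)
    (hv_top : ∀ x : K, v x = ⊤ ↔ x = 0)
    (hv_mul : ∀ x y : K, v (x * y) = v x + v y) (x : K) : v (-x) = v x := by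
  have h := hv_mul (-1) (-1)
  obtain ⟨a, ha⟩ := WithTop.ne_top_iff_exists.mp
    (fun h => neg_ne_zero.mpr one_ne_zero ((hv_top (-1)).mp h))
  rw [neg_mul_neg, mul_one, valuation_one v hv_top hv_mul, ← ha] at h
  norm_cast at h
  have ha0 : a = 0 := by linarith
  rw [← neg_one_mul, hv_mul, ← ha, ha0, WithTop.coe_zero, zero_add]

theorem valuation_pow {K : Type*} [Field K] (v : K → WithTop ℝ)
    (hv_top : ∀ x : K, v x = ⊤ ↔ x = 0)
    (hv_mul : ∀ x y : K, v (x * y) = v x + v y) (x : K) (n : ℕ) : v (x ^ n) = n • v x := by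
  induction n with
  | zero => rw [pow_zero, zero_nsmul, valuation_one v hv_top hv_mul]
  | succ k ih => rw [pow_succ, hv_mul, ih, succ_nsmul]

/-- If three elements sum to zero, none has value smaller than both others. -/
theorem min_valuation_le_of_add_eq_zero {K : Type*} [Field K] (v : K → WithTop ℝ)
    (hv_top : ∀ x : K, v x = ⊤ ↔ x = 0)
    (hv_mul : ∀ x y : K, v (x * y) = v x + v y)
    (hv_add : ∀ x y : K, min (v x) (v y) ≤ v (x + y))
    {a b c : K} (h : a + b + c = 0) : min (v a) (v b) ≤ v c := by
  rw [← valuation_neg v hv_top hv_mul c, ← eq_neg_of_add_eq_zero_left h]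
  exact hv_add a b


/-- Newton-polygon analysis of the `π`-torsion polynomial
`[π]_u(X) = X^{q²} + u X^q + π X` of the universal formal module of height 2. -/
theorem stmt_0 (p f q : ℕ) (hp : p.Prime) (hf : 0 < f) (hq : q = p ^ f)
    (K : Type*) [Field K] [IsAlgClosed K] [CharP K p]
    (v : K → WithTop ℝ)
    (hv_top : ∀ x : K, v x = ⊤ ↔ x = 0)
    (hv_mul : ∀ x y : K, v (x * y) = v x + v y)
    (hv_add : ∀ x y : K, min (v x) (v y) ≤ v (x + y))
    (π : K) (hπ : v π = 1)
    (u X : K) (hu : 0 < v u) (hX : X ≠ 0)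
    (heq : X ^ q ^ 2 + u * X ^ q + π * X = 0) :
    (((1 / ((q : ℝ) ^ 2 - 1) : ℝ) : WithTop ℝ) < v X →
      (q - 1) • v X + v u = 1 ∧ v u < (((q : ℝ) / ((q : ℝ) + 1) : ℝ) : WithTop ℝ)) ∧
    (v X = ((1 / ((q : ℝ) ^ 2 - 1) : ℝ) : WithTop ℝ) →
      (((q : ℝ) / ((q : ℝ) + 1) : ℝ) : WithTop ℝ) ≤ v u) ∧
    (v X < ((1 / ((q : ℝ) ^ 2 - 1) : ℝ) : WithTop ℝ) →
      (q * (q - 1)) • v X = v u ∧ v u < (((q : ℝ) / ((q : ℝ) + 1) : ℝ) : WithTop ℝ)) := by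
  have hq2 : 2 ≤ q := hq ▸ hp.two_le.trans (Nat.le_self_pow hf.ne' p)
  have hqR : (2 : ℝ) ≤ q := by exact_mod_cast hq2
  have key {a b c : K} (h : a + b + c = 0) : min (v a) (v b) ≤ v c :=
    min_valuation_le_of_add_eq_zero v hv_top hv_mul hv_add h
  have h₁ := key heq
  have h₂ := key (a := X ^ q ^ 2) (b := π * X) (c := u * X ^ q) (by linear_combination heq)
  have h₃ := key (a := u * X ^ q) (b := π * X) (c := X ^ q ^ 2) (by linear_combination heq)
  obtain ⟨x, hx⟩ := WithTop.ne_top_iff_exists.mp (fun h => hX ((hv_top X).mp h))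
  simp only [hv_mul, valuation_pow v hv_top hv_mul, hπ, ← hx] at h₁ h₂ h₃ ⊢
  have hsmul (n : ℕ) : n • (x : WithTop ℝ) = ((n * x : ℝ) : WithTop ℝ) := by
    rw [← nsmul_eq_mul, WithTop.coe_nsmul]
  have hpos : (0 : ℝ) < (q : ℝ) ^ 2 - 1 := by nlinarith
  have hpos' : (0 : ℝ) < (q : ℝ) + 1 := by linarith
  simp only [hsmul, Nat.cast_pow, Nat.cast_mul, Nat.cast_pred (two_pos.trans_le hq2)]
    at h₁ h₂ h₃ ⊢
  rw [← WithTop.coe_one] at h₁ h₂ h₃ ⊢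
  cases hw : v u with
  | top =>
    simp only [hw, WithTop.top_add, ← WithTop.coe_add, WithTop.coe_le_coe, WithTop.coe_lt_coe,
      min_top_left, min_top_right, le_top] at h₁ h₃ ⊢
    have hxe : x = 1 / ((q : ℝ) ^ 2 - 1) := by
      rw [eq_div_iff hpos.ne']
      linarith
    exact ⟨fun h => absurd hxe h.ne', fun _ => trivial, fun h => absurd hxe h.ne⟩
  | coe w =>
    simp only [hw, ← WithTop.coe_add, WithTop.coe_le_coe, WithTop.coe_lt_coe,
      WithTop.coe_inj, min_le_iff] at h₁ h₂ h₃ ⊢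
    rw [lt_div_iff₀ hpos', div_le_iff₀ hpos', div_lt_iff₀ hpos, lt_div_iff₀ hpos,
      eq_div_iff hpos.ne']
    refine ⟨fun h => ?_, fun h => ?_, fun h => ?_⟩
    · have hw' : (q - 1) * x + w = 1 := by
        rcases h₁ with h₁ | h₁ <;> rcases h₂ with h₂ | h₂ <;> linarith
      exact ⟨hw', by nlinarith⟩
    · have hw' : (q ^ 2 - q) * x ≤ w := by
        rcases h₂ with h₂ | h₂ <;> linarith
      nlinarith
    · have hw' : q * (q - 1) * x = w := by
        rcases h₃ with h₃ | h₃ <;> rcases h₂ with h₂ | h₂ <;> linarith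
      exact ⟨hw', by nlinarith⟩
end

section
/- (Core estimate showing the space W_{1,3} is an annulus of width 1/(q²−1).) Suppose u, X, Y ∈ K with v(u) > 0, X ≠ 0, Y ≠ 0, [π]_u(X) = [π]_u(Y) = 0, X^q Y − X Y^q = π₁, v(X) = (1−v(u))/(q−1) > 1/(q²−1), and v(Y) = v(u)/(q(q−1)) < 1/(q²−1). Then v(X Y^q + π₁) > 1/(q−1); that is, X Y^q equals −π₁ up to terms of valuation strictly greater than 1/(q−1). -/
/-- on the locus W_{1,3}, one has X·Y^q = −π₁ up to terms of
valuation strictly greater than 1/(q−1); here v(X) = (1−v(u))/(q−1) is encoded as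
(q−1)•v(X) + v(u) = 1 and v(Y) = v(u)/(q(q−1)) as (q(q−1))•v(Y) = v(u). -/
theorem stmt_2 (p f q : ℕ) (hp : p.Prime) (hf : 0 < f) (hq : q = p ^ f)
    (K : Type*) [Field K] [IsAlgClosed K] [CharP K p]
    (v : K → WithTop ℝ)
    (hv_top : ∀ x : K, v x = ⊤ ↔ x = 0)
    (hv_mul : ∀ x y : K, v (x * y) = v x + v y)
    (hv_add : ∀ x y : K, min (v x) (v y) ≤ v (x + y))
    (π : K) (hπ : v π = 1)
    (π₁ : K) (hπ₁ : π₁ ^ (q - 1) = π)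
    (u X Y : K) (hu : 0 < v u) (hX : X ≠ 0) (hY : Y ≠ 0)
    (htorX : X ^ q ^ 2 + u * X ^ q + π * X = 0)
    (htorY : Y ^ q ^ 2 + u * Y ^ q + π * Y = 0)
    (hMoore : X ^ q * Y - X * Y ^ q = π₁)
    (hvX : (q - 1) • v X + v u = 1)
    (hvX' : ((1 / ((q : ℝ) ^ 2 - 1) : ℝ) : WithTop ℝ) < v X)
    (hvY : (q * (q - 1)) • v Y = v u)
    (hvY' : v Y < ((1 / ((q : ℝ) ^ 2 - 1) : ℝ) : WithTop ℝ)) :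
    ((1 / ((q : ℝ) - 1) : ℝ) : WithTop ℝ) < v (X * Y ^ q + π₁) := by
  have hq2 : 2 ≤ q := by
    rw [hq]
    exact hp.two_le.trans (Nat.le_self_pow hf.ne' p)
  have hMoore' : X * Y ^ q + π₁ = X ^ q * Y := by rw [← hMoore]; ring
  have hv_pow : ∀ n : ℕ, v (X ^ (n + 1)) = (n + 1) • v X := by
    intro n
    induction n with
    | zero => simp
    | succ n ih => rw [pow_succ, hv_mul, ih, succ_nsmul _ (n + 1)]
  obtain ⟨n, rfl⟩ : ∃ n, q = n + 1 := ⟨q - 1, by omega⟩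
  obtain ⟨x, hx⟩ := WithTop.ne_top_iff_exists.mp (mt (hv_top X).mp hX)
  obtain ⟨y, hy⟩ := WithTop.ne_top_iff_exists.mp (mt (hv_top Y).mp hY)
  rw [hMoore', hv_mul, hv_pow]
  rw [← hvY] at hvX
  rw [← hx] at hvX hvX' ⊢
  rw [← hy] at hvX ⊢
  rw [Nat.add_sub_cancel] at hvX
  have hn : (1 : ℝ) ≤ n := by exact_mod_cast (by omega : 1 ≤ n)
  have hvX_real : n • x + ((n + 1) * n) • y = 1 := by exact_mod_cast hvX
  have hvX'_real : 1 / (((n + 1 : ℕ) : ℝ) ^ 2 - 1) < x := WithTop.coe_lt_coe.mp hvX'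
  suffices h : 1 / (((n + 1 : ℕ) : ℝ) - 1) < (n + 1) • x + y by exact_mod_cast h
  simp only [nsmul_eq_mul] at hvX_real ⊢
  push_cast at hvX_real hvX'_real ⊢
  rw [div_lt_iff₀ (by nlinarith)] at hvX'_real
  rw [add_sub_cancel_right, div_lt_iff₀ (by linarith)]
  nlinarith
end

section
/- (Core of the claim that the space W_{3,3} is a disjoint union of (q−1) annuli of width 1/(q²−1).) Suppose u, X, Y ∈ K with 0 < v(u) < q/(q+1), X ≠ 0, Y ≠ 0, [π]_u(X) = [π]_u(Y) = 0, X^q Y − X Y^q = π₁, and v(X) = v(Y) = v(u)/(q(q−1)). Then there exists ζ ∈ K with ζ^{q−1} = 1 such that v(X − ζY) = (1 − v(u))/(q−1); in particular v(X − ζY) > v(Y). -/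
section AdditiveValuation

variable {K : Type*} [Field K] {v : K → WithTop ℝ}

theorem additiveValuation_one (hv_top : ∀ x : K, v x = ⊤ ↔ x = 0)
    (hv_mul : ∀ x y : K, v (x * y) = v x + v y) : v 1 = 0 := by
  have h := hv_mul 1 1
  lift v 1 to ℝ using (mt (hv_top 1).1 one_ne_zero) with r hr
  rw [mul_one, ← hr] at h
  norm_cast at h ⊢
  linarith

theorem additiveValuation_neg (hv_top : ∀ x : K, v x = ⊤ ↔ x = 0)
    (hv_mul : ∀ x y : K, v (x * y) = v x + v y) (x : K) : v (-x) = v x := by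
  have h := hv_mul (-1) (-1)
  rw [neg_mul_neg, one_mul, additiveValuation_one hv_top hv_mul] at h
  have h0 : v (-1) = 0 := by
    lift v (-1) to ℝ using (mt (hv_top (-1)).1 (neg_ne_zero.2 one_ne_zero)) with r hr
    norm_cast at h ⊢
    linarith
  rw [← neg_one_mul, hv_mul, h0, zero_add]

theorem additiveValuation_pow (hv_top : ∀ x : K, v x = ⊤ ↔ x = 0)
    (hv_mul : ∀ x y : K, v (x * y) = v x + v y) (x : K) (n : ℕ) : v (x ^ n) = n • v x := by
  induction n with
  | zero => simpa using additiveValuation_one hv_top hv_mul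
  | succ n ih => rw [pow_succ, hv_mul, ih, succ_nsmul]

theorem additiveValuation_sub_one_of_pos (hv_top : ∀ x : K, v x = ⊤ ↔ x = 0)
    (hv_mul : ∀ x y : K, v (x * y) = v x + v y)
    (hv_add : ∀ x y : K, min (v x) (v y) ≤ v (x + y)) {x : K} (hx : 0 < v x) :
    v (x - 1) = 0 := by
  have h1 := additiveValuation_one hv_top hv_mul
  have hneg := additiveValuation_neg hv_top hv_mul
  apply le_antisymm
  · have h := hv_add (-(x - 1)) x
    rw [show -(x - 1) + x = 1 by ring, hneg, h1] at h
    exact (min_le_iff.1 h).resolve_right hx.not_ge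
  · have h := hv_add x (-1)
    rw [hneg, h1, min_eq_right hx.le] at h
    rwa [sub_eq_add_neg]

theorem exists_pos_additiveValuation_of_prod (hv_top : ∀ x : K, v x = ⊤ ↔ x = 0)
    (hv_mul : ∀ x y : K, v (x * y) = v x + v y) (s : Multiset K) (h : 0 < v s.prod) :
    ∃ a ∈ s, 0 < v a := by
  contrapose! h
  induction s using Multiset.induction_on with
  | empty => simpa using (additiveValuation_one hv_top hv_mul).le
  | cons a s ih =>
    rw [Multiset.prod_cons, hv_mul]
    exact add_nonpos (h a (Multiset.mem_cons_self a s))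
      (ih fun b hb => h b (Multiset.mem_cons_of_mem hb))

theorem exists_root_of_unity_additiveValuation_sub_pos [IsAlgClosed K]
    (hv_top : ∀ x : K, v x = ⊤ ↔ x = 0) (hv_mul : ∀ x y : K, v (x * y) = v x + v y)
    {n : ℕ} (hn : n ≠ 0) {t : K} (ht : 0 < v (t ^ n - 1)) :
    ∃ ζ : K, ζ ^ n = 1 ∧ 0 < v (t - ζ) := by
  set P : Polynomial K := Polynomial.X ^ n - Polynomial.C 1 with hP
  have hmonic : P.Monic := Polynomial.monic_X_pow_sub_C 1 hn
  have hprod := (IsAlgClosed.splits P).eq_prod_roots_of_monic hmonic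
  have heval : t ^ n - 1 = (P.roots.map fun a => t - a).prod := by
    have h := congrArg (Polynomial.eval t) hprod
    rw [Polynomial.eval_multiset_prod, Multiset.map_map] at h
    simpa [hP] using h
  rw [heval] at ht
  obtain ⟨b, hb, hb0⟩ := exists_pos_additiveValuation_of_prod hv_top hv_mul _ ht
  obtain ⟨ζ, hζ, rfl⟩ := Multiset.mem_map.1 hb
  refine ⟨ζ, ?_, hb0⟩
  have := Polynomial.isRoot_of_mem_roots hζ
  simpa [hP, Polynomial.IsRoot, sub_eq_zero] using this

end AdditiveValuation


/-- on the locus W_{3,3} there is a (q−1)-st root of unity ζ with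
v(X − ζY) = (1 − v(u))/(q−1) (encoded as (q−1)•v(X−ζY) + v(u) = 1);
in particular v(X − ζY) > v(Y). -/
theorem stmt_3 (p f q : ℕ) (hp : p.Prime) (hf : 0 < f) (hq : q = p ^ f)
    (K : Type*) [Field K] [IsAlgClosed K] [CharP K p]
    (v : K → WithTop ℝ)
    (hv_top : ∀ x : K, v x = ⊤ ↔ x = 0)
    (hv_mul : ∀ x y : K, v (x * y) = v x + v y)
    (hv_add : ∀ x y : K, min (v x) (v y) ≤ v (x + y))
    (π : K) (hπ : v π = 1)
    (π₁ : K) (hπ₁ : π₁ ^ (q - 1) = π)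
    (u X Y : K) (hu : 0 < v u)
    (hu' : v u < (((q : ℝ) / ((q : ℝ) + 1) : ℝ) : WithTop ℝ))
    (hX : X ≠ 0) (hY : Y ≠ 0)
    (htorX : X ^ q ^ 2 + u * X ^ q + π * X = 0)
    (htorY : Y ^ q ^ 2 + u * Y ^ q + π * Y = 0)
    (hMoore : X ^ q * Y - X * Y ^ q = π₁)
    (hvX : (q * (q - 1)) • v X = v u)
    (hvY : (q * (q - 1)) • v Y = v u) :
    ∃ ζ : K, ζ ^ (q - 1) = 1 ∧
      (q - 1) • v (X - ζ * Y) + v u = 1 ∧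
      v Y < v (X - ζ * Y) := by
  have hq2 : 2 ≤ q := hq ▸ hp.two_le.trans (Nat.le_self_pow hf.ne' p)
  have hpow := additiveValuation_pow hv_top hv_mul
  have : Fact p.Prime := ⟨hp⟩
  obtain ⟨n, rfl⟩ : ∃ n, q = n + 1 := ⟨q - 1, by omega⟩
  simp only [Nat.add_sub_cancel] at *
  have hn : 1 ≤ n := by omega
  have hnR : (1 : ℝ) ≤ n := by exact_mod_cast hn
  obtain ⟨t, rfl⟩ : ∃ t, X = t * Y := ⟨X / Y, by field_simp⟩
  have hπ₁n := hpow π₁ n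
  rw [hπ₁, hπ] at hπ₁n
  have hπ₁0 : π₁ ≠ 0 := by
    rintro rfl
    rw [zero_pow (by omega)] at hπ₁
    rw [← hπ₁, (hv_top 0).2 rfl] at hπ
    exact absurd hπ (by simp)
  have ht0 : t ≠ 0 := left_ne_zero_of_mul hX
  have hfac : Y ^ (n + 2) * (t * (t ^ n - 1)) = π₁ := by rw [← hMoore]; ring
  have hd0 : t ^ n - 1 ≠ 0 := by
    intro h
    rw [h] at hfac
    exact hπ₁0 (by simpa using hfac.symm)
  have hvfac := congrArg v hfac
  rw [hv_mul, hv_mul, hpow] at hvfac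
  rw [hv_mul] at hvX
  obtain ⟨a, ha⟩ := WithTop.ne_top_iff_exists.1 hu'.ne_top
  obtain ⟨y, hy⟩ := WithTop.ne_top_iff_exists.1 (mt (hv_top Y).1 hY)
  obtain ⟨τ, hτ⟩ := WithTop.ne_top_iff_exists.1 (mt (hv_top t).1 ht0)
  obtain ⟨c, hc⟩ := WithTop.ne_top_iff_exists.1 (mt (hv_top π₁).1 hπ₁0)
  obtain ⟨d, hd⟩ := WithTop.ne_top_iff_exists.1 (mt (hv_top _).1 hd0)
  rw [← ha, ← hy] at hvY
  rw [← ha, ← hy, ← hτ] at hvX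
  rw [← hy, ← hτ, ← hd, ← hc] at hvfac
  rw [← hc] at hπ₁n
  rw [← ha] at hu'
  norm_cast at hvX hvY hvfac hπ₁n hu'
  simp only [nsmul_eq_mul] at hvX hvY hvfac hπ₁n
  push_cast at hvX hvY hvfac hu'
  rw [lt_div_iff₀ (by positivity)] at hu'
  have hτ0 : τ = 0 := by
    have h : ((n : ℝ) + 1) * n * τ = 0 := by linarith
    exact (mul_eq_zero.1 h).resolve_left (by positivity)
  subst hτ0
  have hd' : ((n : ℝ) + 1) * n * d = (n + 1) - (n + 2) * a := by
    linear_combination ((n : ℝ) + 1) * n * hvfac - ((n : ℝ) + 1) * hπ₁n - ((n : ℝ) + 2) * hvY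
  have hdpos : 0 < d := by
    have h : 0 < ((n : ℝ) + 1) * n * d := by rw [hd']; linarith
    exact pos_of_mul_pos_right h (by positivity)
  obtain ⟨ζ, hζ, hζv⟩ := exists_root_of_unity_additiveValuation_sub_pos (v := v) (t := t) hv_top
    hv_mul (n := n) (by omega) (by rw [← hd]; exact_mod_cast hdpos)
  have hfrob : (t - ζ) * ((t - ζ) ^ n - 1) = t * (t ^ n - 1) := by
    have h : (t - ζ) ^ (n + 1) = t ^ (n + 1) - ζ ^ (n + 1) := by
      rw [hq]; exact sub_pow_char_pow t ζ f
    linear_combination h - ζ * hζ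
  have hsv : v (t - ζ) = (d : WithTop ℝ) := by
    have h := congrArg v hfrob
    have hpos : 0 < v ((t - ζ) ^ n) := by
      rw [hpow]
      exact nsmul_pos hζv (by omega)
    rw [hv_mul, hv_mul, additiveValuation_sub_one_of_pos hv_top hv_mul hv_add hpos, ← hτ,
      ← hd] at h
    simpa using h
  refine ⟨ζ, hζ, ?_⟩
  rw [← sub_mul, hv_mul, hsv, ← hy, ← ha]
  norm_cast
  refine ⟨?_, by linarith⟩
  rw [nsmul_eq_mul]
  have h : ((n : ℝ) + 1) * (n * (d + y) + a - 1) = 0 := by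
    linear_combination hd' + hvY
  linarith [(mul_eq_zero.1 h).resolve_left (by positivity)]
end

section
/- (Reduction of the space Y^{π₂}_{3,1,e₁}.) Suppose u, X₂, Y₂ ∈ K satisfy: v(u) = 1/(q+1), [π]_u([π]_u(X₂)) = [π]_u([π]_u(Y₂)) = 0, μ₂(X₂,Y₂) = π₂, and the valuation conditions v(X₁) = q/(q²−1), v(X₂) = 1/(q(q²−1)), v(Y₁) = 1/(q(q²−1)), v(Y₂) = 1/(q³(q²−1)), where X₁ = [π]_u(X₂) and Y₁ = [π]_u(Y₂). Let α ∈ K with α^{q²(q+1)} = π₂, and set x = X₂/α^{q²}, y = Y₂/α. Then v(x) = v(y) = 0 and v(x y^{q³} − x^q y^{q²} − 1) > 0; that is, the residues satisfy −x̄^q ȳ^{q²} + x̄ ȳ^{q³} = 1. -/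
section RealLowerBounds

variable {K : Type*} [Field K] (w : AddValuation K (WithTop ℝ))

theorem AddValuation.coe_le_map_mul {a b : K} {r s : ℝ} (ha : (r : WithTop ℝ) ≤ w a)
    (hb : (s : WithTop ℝ) ≤ w b) : ((r + s : ℝ) : WithTop ℝ) ≤ w (a * b) := by
  rw [w.map_mul, WithTop.coe_add]
  exact add_le_add ha hb

theorem AddValuation.coe_le_map_pow {a : K} {r : ℝ} (ha : (r : WithTop ℝ) ≤ w a) (n : ℕ) :
    ((n * r : ℝ) : WithTop ℝ) ≤ w (a ^ n) := by
  rw [w.map_pow, ← nsmul_eq_mul, WithTop.coe_nsmul]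
  exact nsmul_le_nsmul_right ha n

theorem AddValuation.map_pow_of_eq_coe {a : K} {r : ℝ} (ha : w a = (r : WithTop ℝ)) (n : ℕ) :
    w (a ^ n) = ((n * r : ℝ) : WithTop ℝ) := by
  rw [w.map_pow, ← nsmul_eq_mul, WithTop.coe_nsmul, ha]

theorem AddValuation.eq_coe_of_map_pow {a : K} {r : ℝ} {n : ℕ} (hn : n ≠ 0)
    (ha : w (a ^ n) = ((n * r : ℝ) : WithTop ℝ)) : w a = (r : WithTop ℝ) := by
  have h0 : w a ≠ ⊤ := by
    intro h
    rw [w.top_iff] at h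
    rw [h, zero_pow hn, w.map_zero] at ha
    exact WithTop.top_ne_coe ha
  obtain ⟨s, hs⟩ := WithTop.ne_top_iff_exists.mp h0
  rw [w.map_pow_of_eq_coe hs.symm, WithTop.coe_inj] at ha
  rw [← hs, mul_left_cancel₀ (Nat.cast_ne_zero.mpr hn) ha]

theorem AddValuation.map_div_eq_zero {a b : K} {r : ℝ} (ha : w a = (r : WithTop ℝ))
    (hb : w b = (r : WithTop ℝ)) : w (a / b) = 0 := by
  have hb0 : b ≠ 0 := by
    rintro rfl
    rw [w.map_zero] at hb
    exact WithTop.top_ne_coe hb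
  have h : w (a / b) + (r : WithTop ℝ) = 0 + (r : WithTop ℝ) := by
    rw [← hb, ← w.map_mul, div_mul_cancel₀ a hb0, ha, hb, zero_add]
  exact WithTop.add_right_cancel WithTop.coe_ne_top h

theorem AddValuation.map_pos_of_mul {a b : K} {r s : ℝ} (ha : w a = (r : WithTop ℝ))
    (hab : (s : WithTop ℝ) ≤ w (a * b)) (hrs : r < s) : 0 < w b := by
  rw [w.map_mul, ha] at hab
  generalize w b = c at hab ⊢
  induction c using WithTop.recTopCoe with
  | top => exact WithTop.coe_lt_top 0
  | coe c =>
    rw [← WithTop.coe_add, WithTop.coe_le_coe] at hab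
    exact_mod_cast (by linarith : (0 : ℝ) < c)

/-- The valuation of a root of `π T - T ^ q = π₁`, where `π₁ ^ (q - 1) = π`
and `π` has valuation `(q - 1) * r`. -/
theorem AddValuation.map_of_mul_sub_pow_eq {q : ℕ} (hq : 2 ≤ q) {π π₁ z : K} {r : ℝ} (hr : 0 < r)
    (hπ : w π = (((q - 1) * r : ℝ) : WithTop ℝ)) (hπ₁ : π₁ ^ (q - 1) = π)
    (hz : π * z - z ^ q = π₁) : w z = ((r / q : ℝ) : WithTop ℝ) := by
  have hq' : (2 : ℝ) ≤ q := by exact_mod_cast hq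
  have h₁ : w π₁ = (r : WithTop ℝ) := by
    refine w.eq_coe_of_map_pow (n := q - 1) (by omega) ?_
    rw [hπ₁, hπ, Nat.cast_sub (by omega), Nat.cast_one]
  have hz0 : w z ≠ ⊤ := by
    intro h
    rw [w.top_iff] at h
    rw [← hz, h, mul_zero, zero_pow (by omega), sub_zero, w.map_zero] at h₁
    exact WithTop.top_ne_coe h₁
  obtain ⟨s, hs⟩ := WithTop.ne_top_iff_exists.mp hz0
  have hm : w (π * z) = (((q - 1) * r + s : ℝ) : WithTop ℝ) := by
    rw [w.map_mul, hπ, ← hs, WithTop.coe_add]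
  have hp := w.map_pow_of_eq_coe hs.symm q
  have key : q * s = r := by
    rcases lt_or_ge (q * s) ((q - 1) * r + s) with h | h
    · have := w.map_sub_eq_of_lt_right (x := π * z) (y := z ^ q)
        (by rw [hm, hp]; exact_mod_cast h)
      rw [hz, h₁, hp] at this
      exact_mod_cast this.symm
    · exfalso
      have h2 := w.map_le_sub (x := π * z) (y := z ^ q) hm.ge
        (by rw [hp]; exact_mod_cast h)
      rw [hz, h₁, WithTop.coe_le_coe] at h2
      have hrs : r ≤ s :=
        le_of_mul_le_mul_left (by linarith : (q - 1) * r ≤ (q - 1) * s) (by linarith)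
      nlinarith
  rw [← hs, ← key, mul_div_cancel_left₀ _ (by positivity)]

end RealLowerBounds


/-- reduction of the space Y^{π₂}_{3,1,e₁}. After rescaling
x = X₂/α^{q²}, y = Y₂/α (with α^{q²(q+1)} = π₂), one has v(x) = v(y) = 0 and the
residues satisfy the Deligne–Lusztig equation −x^q y^{q²} + x y^{q³} = 1. -/
theorem stmt_6 (p f q : ℕ) (hp : p.Prime) (hf : 0 < f) (hq : q = p ^ f)
    (K : Type*) [Field K] [IsAlgClosed K] [CharP K p]
    (v : K → WithTop ℝ)
    (hv_top : ∀ x : K, v x = ⊤ ↔ x = 0)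
    (hv_mul : ∀ x y : K, v (x * y) = v x + v y)
    (hv_add : ∀ x y : K, min (v x) (v y) ≤ v (x + y))
    (π : K) (hπ : v π = 1)
    (π₁ : K) (hπ₁ : π₁ ^ (q - 1) = π)
    (π₂ : K) (hπ₂ : π * π₂ - π₂ ^ q = π₁)
    (u X₂ Y₂ X₁ Y₁ : K)
    (hX₁ : X₁ = X₂ ^ q ^ 2 + u * X₂ ^ q + π * X₂)
    (hY₁ : Y₁ = Y₂ ^ q ^ 2 + u * Y₂ ^ q + π * Y₂)
    (htorX : X₁ ^ q ^ 2 + u * X₁ ^ q + π * X₁ = 0)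
    (htorY : Y₁ ^ q ^ 2 + u * Y₁ ^ q + π * Y₁ = 0)
    (hμ₂ : X₁ * Y₂ ^ q - X₁ ^ q * Y₂ - X₂ ^ q * Y₁ + X₂ * Y₁ ^ q = π₂)
    (hu : v u = ((1 / ((q : ℝ) + 1) : ℝ) : WithTop ℝ))
    (hvX₁ : v X₁ = (((q : ℝ) / ((q : ℝ) ^ 2 - 1) : ℝ) : WithTop ℝ))
    (hvX₂ : v X₂ = ((1 / ((q : ℝ) * ((q : ℝ) ^ 2 - 1)) : ℝ) : WithTop ℝ))
    (hvY₁ : v Y₁ = ((1 / ((q : ℝ) * ((q : ℝ) ^ 2 - 1)) : ℝ) : WithTop ℝ))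
    (hvY₂ : v Y₂ = ((1 / ((q : ℝ) ^ 3 * ((q : ℝ) ^ 2 - 1)) : ℝ) : WithTop ℝ))
    (α : K) (hα : α ^ (q ^ 2 * (q + 1)) = π₂)
    (x y : K) (hx : x = X₂ / α ^ q ^ 2) (hy : y = Y₂ / α) :
    v x = 0 ∧ v y = 0 ∧
    0 < v (x * y ^ q ^ 3 - x ^ q * y ^ q ^ 2 - 1) := by
  have h1 : v 1 = 0 := by
    have h := hv_mul 1 1
    have ht : v 1 ≠ ⊤ := fun h => one_ne_zero ((hv_top 1).1 h)
    rw [mul_one] at h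
    exact WithTop.add_right_cancel ht (by rw [← h, zero_add])
  let w : AddValuation K (WithTop ℝ) :=
    AddValuation.of v ((hv_top 0).2 rfl) h1 hv_add hv_mul
  change w π = 1 at hπ
  change w u = _ at hu
  change w X₁ = _ at hvX₁
  change w X₂ = _ at hvX₂
  change w Y₁ = _ at hvY₁
  change w Y₂ = _ at hvY₂
  change w x = 0 ∧ w y = 0 ∧ 0 < w (x * y ^ q ^ 3 - x ^ q * y ^ q ^ 2 - 1)
  clear_value w
  have : Fact p.Prime := ⟨hp⟩
  have hq2 : 2 ≤ q := hq ▸ hp.two_le.trans (Nat.le_self_pow hf.ne' p)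
  have hQ : (2 : ℝ) ≤ q := by exact_mod_cast hq2
  obtain ⟨c, hc, hqc⟩ : ∃ c : ℝ, 0 ≤ c ∧ (q : ℝ) = c + 2 := ⟨q - 2, by linarith, by ring⟩
  have hQ1 : (0 : ℝ) < (q : ℝ) ^ 2 - 1 := by nlinarith
  have hQ1' : (q : ℝ) ^ 2 - 1 ≠ 0 := hQ1.ne'
  obtain ⟨t, ht⟩ : ∃ t : ℝ, t = 1 / ((q : ℝ) ^ 3 * ((q : ℝ) ^ 2 - 1)) := ⟨_, rfl⟩
  have ht0 : 0 < t := by rw [ht]; positivity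
  rw [← ht] at hvY₂
  rw [show (1 / ((q : ℝ) * ((q : ℝ) ^ 2 - 1)) : ℝ) = q ^ 2 * t by rw [ht]; field_simp]
    at hvX₂
  rw [show ((q : ℝ) / ((q : ℝ) ^ 2 - 1) : ℝ) = q ^ 4 * t by rw [ht]; field_simp] at hvX₁
  rw [show (1 / ((q : ℝ) + 1) : ℝ) = (q ^ 4 - q ^ 3) * t by rw [ht]; field_simp; ring] at hu
  have hπ' : w π = (((q - 1) * ((q ^ 4 + q ^ 3) * t) : ℝ) : WithTop ℝ) := by
    rw [hπ, show ((q - 1) * ((q ^ 4 + q ^ 3) * t) : ℝ) = 1 by rw [ht]; field_simp; ring,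
      WithTop.coe_one]
  have hvπ₂ := w.map_of_mul_sub_pow_eq hq2 (by positivity) hπ' hπ₁ hπ₂
  rw [show ((q ^ 4 + q ^ 3) * t / q : ℝ) = (q ^ 3 + q ^ 2) * t by field_simp] at hvπ₂
  have hvα : w α = (t : WithTop ℝ) := by
    refine w.eq_coe_of_map_pow (n := q ^ 2 * (q + 1)) (by positivity) ?_
    rw [hα, hvπ₂]
    congr 1
    push_cast
    ring
  have hα0 : α ≠ 0 := by
    rintro rfl
    rw [w.map_zero] at hvα
    exact WithTop.top_ne_coe hvα
  refine ⟨?_, ?_, ?_⟩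
  · rw [hx]
    refine w.map_div_eq_zero hvX₂ ?_
    rw [w.map_pow_of_eq_coe hvα]
    push_cast
    rfl
  · rw [hy]
    exact w.map_div_eq_zero hvY₂ hvα
  · obtain ⟨δ, hδ⟩ : ∃ δ, δ = u * Y₂ ^ q + π * Y₂ := ⟨_, rfl⟩
    have hY : Y₁ = Y₂ ^ q ^ 2 + δ := by rw [hY₁, hδ, add_assoc]
    have hYq : Y₁ ^ q = Y₂ ^ q ^ 3 + δ ^ q := by
      rw [hY, pow_succ q 2, pow_mul]
      subst hq
      exact add_pow_char_pow ..
    have bound {a : K} {r s : ℝ} (h : (r : WithTop ℝ) ≤ w a) (hrs : s ≤ r) :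
        (s : WithTop ℝ) ≤ w a := (WithTop.coe_le_coe.mpr hrs).trans h
    have hvδ : (((q ^ 4 - q ^ 3 + q) * t : ℝ) : WithTop ℝ) ≤ w δ := by
      rw [hδ]
      refine w.map_le_add (bound (w.coe_le_map_mul hu.ge (w.coe_le_map_pow hvY₂.ge q)) ?_)
        (bound (w.coe_le_map_mul hπ'.ge hvY₂.ge) ?_)
      · exact le_of_eq (by ring)
      · suffices (q ^ 4 - q ^ 3 + q : ℝ) ≤ (q - 1) * (q ^ 4 + q ^ 3) + 1 by nlinarith
        rw [hqc, ← sub_nonneg]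
        ring_nf
        positivity
    have hE : π₂ * (x * y ^ q ^ 3 - x ^ q * y ^ q ^ 2 - 1) =
        X₂ ^ q * δ - X₂ * δ ^ q - (X₁ * Y₂ ^ q - X₁ ^ q * Y₂) := by
      have e1 : π₂ = α ^ q ^ 2 * α ^ q ^ 3 := by rw [← hα, ← pow_add]; ring_nf
      have e2 : π₂ * (x * y ^ q ^ 3) = X₂ * Y₂ ^ q ^ 3 := by
        rw [e1, hx, hy, div_pow]; field_simp
      have e3 : π₂ * (x ^ q * y ^ q ^ 2) = X₂ ^ q * Y₂ ^ q ^ 2 := by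
        rw [e1, hx, hy, div_pow, div_pow, ← pow_mul, ← pow_succ]; field_simp
      rw [mul_sub, mul_sub, e2, e3]
      linear_combination hμ₂ - X₂ * hYq + X₂ ^ q * hY
    refine w.map_pos_of_mul (s := (q ^ 4 + q) * t) hvπ₂ ?_ ?_
    · rw [hE]
      refine w.map_le_sub (w.map_le_sub
        (bound (w.coe_le_map_mul (w.coe_le_map_pow hvX₂.ge q) hvδ) ?_)
        (bound (w.coe_le_map_mul hvX₂.ge (w.coe_le_map_pow hvδ q)) ?_))
        (w.map_le_sub (bound (w.coe_le_map_mul hvX₁.ge (w.coe_le_map_pow hvY₂.ge q)) ?_)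
        (bound (w.coe_le_map_mul (w.coe_le_map_pow hvX₁.ge q) hvY₂.ge) ?_))
      · exact le_of_eq (by ring)
      · suffices (q ^ 4 + q : ℝ) ≤ q ^ 2 + q * (q ^ 4 - q ^ 3 + q) by nlinarith
        rw [hqc, ← sub_nonneg]
        ring_nf
        positivity
      · exact le_of_eq (by ring)
      · suffices (q ^ 4 + q : ℝ) ≤ q * q ^ 4 + 1 by nlinarith
        rw [hqc, ← sub_nonneg]
        ring_nf
        positivity
    · refine mul_lt_mul_of_pos_right ?_ ht0
      rw [hqc, ← sub_pos]
      ring_nf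
      positivity
end

section
/- (Core of the claim that the reduction of Y^{π₂}_{3,1,c} has q−1 connected components.) Suppose u, X₂, Y₂ ∈ K satisfy: v(u) = 1/(q+1), [π]_u([π]_u(X₂)) = [π]_u([π]_u(Y₂)) = 0, μ₂(X₂,Y₂) = π₂, and the valuation conditions v(X₁) = v(Y₁) = 1/(q(q²−1)) and v(X₂) = v(Y₂) = 1/(q³(q²−1)), where X₁ = [π]_u(X₂) and Y₁ = [π]_u(Y₂). Then a = X₂/Y₂ satisfies v(a) = 0 and v(a^q − a) = 1/q³; in particular the residue of a lies in F_q^×. -/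
/-- The expansion of the level-2 Moore determinant of `(a * Y, Y)` in terms of `a ^ q - a`. -/
theorem moore_two_expansion {p f q : ℕ} [Fact p.Prime] (hq : q = p ^ f)
    {K : Type*} [Field K] [CharP K p] (π u a Y : K) :
    ((a * Y) ^ q ^ 2 + u * (a * Y) ^ q + π * (a * Y)) * Y ^ q
      - ((a * Y) ^ q ^ 2 + u * (a * Y) ^ q + π * (a * Y)) ^ q * Y
      - (a * Y) ^ q * (Y ^ q ^ 2 + u * Y ^ q + π * Y)
      + (a * Y) * (Y ^ q ^ 2 + u * Y ^ q + π * Y) ^ q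
    = Y ^ (q ^ 2 + q) * (a ^ q - a) ^ q
      + (-(Y ^ (q ^ 3 + 1) * (((a ^ q - a) ^ q) ^ q + (a ^ q - a) ^ q + (a ^ q - a)))
      + (-(π * (Y ^ (q + 1) * (a ^ q - a)))
      + (-(u ^ q * (Y ^ (q ^ 2 + 1) * ((a ^ q - a) ^ q + (a ^ q - a))))
      + -(π ^ q * (Y ^ (q + 1) * (a ^ q - a)))))) := by
  have hadd (x y : K) : (x + y) ^ q = x ^ q + y ^ q := by
    rw [hq]; exact add_pow_char_pow x y p f
  have hsub (x y : K) : (x - y) ^ q = x ^ q - y ^ q := by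
    rw [hq]; exact sub_pow_char_pow x y f
  simp only [hadd, hsub, mul_pow, ← pow_mul, pow_add, pow_one]
  ring

/-- The valuation of an element `y` with `π * y - y ^ q` a `(q - 1)`-st root of `π`. -/
theorem map_eq_of_level_two {K : Type*} [Field K] (w : AddValuation K (WithTop ℝ)) {q : ℕ}
    (hq : 2 ≤ q) {π x y : K} (hπ : w π = 1) (hx : x ^ (q - 1) = π)
    (hy : π * y - y ^ q = x) :
    w y = ((1 / ((q : ℝ) * (q - 1)) : ℝ) : WithTop ℝ) := by
  have hq2 : (2 : ℝ) ≤ q := by exact_mod_cast hq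
  have hq1 : (0 : ℝ) < q - 1 := by linarith
  have hwx : w x = ((1 / ((q : ℝ) - 1) : ℝ) : WithTop ℝ) := by
    have h := congrArg w hx
    rw [w.map_pow, hπ] at h
    cases hr : w x with
    | top =>
      have hx0 : x = 0 := (w.top_iff).1 hr
      rw [← hx, hx0, zero_pow (by omega), w.map_zero] at hπ
      exact absurd hπ (by simp)
    | coe r =>
      rw [hr, ← WithTop.coe_nsmul, ← WithTop.coe_one, WithTop.coe_inj, nsmul_eq_mul,
        Nat.cast_sub (by omega), Nat.cast_one] at h
      rw [WithTop.coe_inj, eq_div_iff hq1.ne']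
      linarith
  cases hs : w y with
  | top =>
    have hy0 : y = 0 := (w.top_iff).1 hs
    rw [hy0, mul_zero, zero_pow (by omega), sub_zero] at hy
    rw [← hy, w.map_zero] at hwx
    exact absurd hwx WithTop.top_ne_coe
  | coe s =>
    have h1 : w (π * y) = ((1 + s : ℝ) : WithTop ℝ) := by
      rw [w.map_mul, hπ, hs]; rfl
    have h2 : w (-(y ^ q)) = ((q * s : ℝ) : WithTop ℝ) := by
      rw [w.map_neg, w.map_pow, hs, ← WithTop.coe_nsmul, nsmul_eq_mul]
    have hr : ((q : ℝ) - 1) * (1 / (q - 1)) = 1 := by field_simp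
    rw [← hy, sub_eq_add_neg] at hwx
    rw [WithTop.coe_inj, eq_div_iff (by positivity)]
    rcases lt_trichotomy (1 + s) (q * s) with h | h | h
    · rw [w.map_add_eq_of_lt_left (by rw [h1, h2]; exact_mod_cast h), h1, WithTop.coe_inj] at hwx
      exfalso
      rw [← hwx] at hr
      nlinarith
    · have := w.map_add (π * y) (-(y ^ q))
      rw [hwx, h1, h2, ← h, min_self, WithTop.coe_le_coe] at this
      exfalso
      nlinarith
    · rw [w.map_add_eq_of_lt_right (by rw [h1, h2]; exact_mod_cast h), h2, WithTop.coe_inj] at hwx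
      rw [← hwx] at hr
      linarith

/-- If `x ^ n` is close to `1`, then `x` is close to an `n`-th root of unity. -/
theorem exists_root_of_unity_near {K : Type*} [Field K] [IsAlgClosed K]
    (w : AddValuation K (WithTop ℝ)) {n : ℕ} (hn : 0 < n) {x : K} (hx : 0 < w (x ^ n - 1)) :
    ∃ ζ : K, ζ ^ n = 1 ∧ 0 < w (x - ζ) := by
  by_contra! H
  have hmonic : (Polynomial.X ^ n - 1 : Polynomial K).Monic :=
    Polynomial.monic_X_pow_sub_C 1 hn.ne'
  have heval := congrArg (Polynomial.eval x)
    ((IsAlgClosed.splits (Polynomial.X ^ n - 1 : Polynomial K)).eq_prod_roots_of_monic hmonic)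
  rw [Polynomial.eval_multiset_prod, Multiset.map_map] at heval
  simp only [Polynomial.eval_sub, Polynomial.eval_pow, Polynomial.eval_X, Polynomial.eval_one,
    Function.comp_def, Polynomial.eval_C] at heval
  rw [heval] at hx
  refine hx.not_ge (Multiset.prod_induction (fun y ↦ w y ≤ 0) _ ?_ w.map_one.le ?_)
  · intro y z hy hz
    rw [w.map_mul]
    exact add_nonpos hy hz
  · intro y hy
    obtain ⟨ζ, hζ, rfl⟩ := Multiset.mem_map.1 hy
    refine H ζ ?_
    have := (Polynomial.mem_roots'.1 hζ).2
    simpa [Polynomial.IsRoot, sub_eq_zero] using this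

/-- The valuation of `b` is determined by the leading terms of the expansion of the level-2
Moore determinant, all valuations being measured in units of `ε`. -/
theorem map_eq_of_moore_two_expansion {K : Type*} [Field K] (w : AddValuation K (WithTop ℝ))
    {q : ℕ} (hq : 2 ≤ q) {ε : ℝ} (hε : 0 < ε) {π u Y b c : K}
    (hπ : w π = ((q ^ 3 * (q ^ 2 - 1) * ε : ℝ) : WithTop ℝ))
    (hu : w u = ((q ^ 3 * (q - 1) * ε : ℝ) : WithTop ℝ))
    (hY : w Y = (ε : WithTop ℝ)) (hb : 0 ≤ w b)
    (hc : w c = (((q ^ 3 + q ^ 2) * ε : ℝ) : WithTop ℝ))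
    (h : Y ^ (q ^ 2 + q) * b ^ q + (-(Y ^ (q ^ 3 + 1) * ((b ^ q) ^ q + b ^ q + b))
      + (-(π * (Y ^ (q + 1) * b)) + (-(u ^ q * (Y ^ (q ^ 2 + 1) * (b ^ q + b)))
      + -(π ^ q * (Y ^ (q + 1) * b))))) = c) :
    w b = (((q ^ 2 - 1) * ε : ℝ) : WithTop ℝ) := by
  have hq2 : (2 : ℝ) ≤ q := by exact_mod_cast hq
  cases ht : w b with
  | top =>
    have hb0 : b = 0 := (w.top_iff).1 ht
    have hq0 : q ≠ 0 := by omega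
    simp only [hb0, zero_pow hq0, mul_zero, add_zero, neg_zero] at h
    rw [← h, w.map_zero] at hc
    exact absurd hc WithTop.top_ne_coe
  | coe t =>
    have ht0 : 0 ≤ t := by rw [ht] at hb; exact_mod_cast hb
    have hYn (n : ℕ) : w (Y ^ n) = ((n * ε : ℝ) : WithTop ℝ) := by
      rw [w.map_pow, hY, ← WithTop.coe_nsmul, nsmul_eq_mul]
    have hbq : w (b ^ q) = ((q * t : ℝ) : WithTop ℝ) := by
      rw [w.map_pow, ht, ← WithTop.coe_nsmul, nsmul_eq_mul]
    have hbqq : w ((b ^ q) ^ q) = ((q * (q * t) : ℝ) : WithTop ℝ) := by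
      rw [w.map_pow, hbq, ← WithTop.coe_nsmul, nsmul_eq_mul]
    have hqt : t ≤ q * t := by nlinarith
    have hqqt : t ≤ q * (q * t) := by nlinarith
    have hb2 : (t : WithTop ℝ) ≤ w (b ^ q + b) :=
      w.map_le_add (by rw [hbq]; exact_mod_cast hqt) ht.ge
    have hb3 : (t : WithTop ℝ) ≤ w ((b ^ q) ^ q + b ^ q + b) :=
      w.map_le_add (w.map_le_add (by rw [hbqq]; exact_mod_cast hqqt)
        (by rw [hbq]; exact_mod_cast hqt)) ht.ge
    have hA : w (Y ^ (q ^ 2 + q) * b ^ q) = (((q ^ 2 + q) * ε + q * t : ℝ) : WithTop ℝ) := by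
      rw [w.map_mul, hYn, hbq, ← WithTop.coe_add]; push_cast; rfl
    have hB : (((q ^ 3 + 1) * ε + t : ℝ) : WithTop ℝ)
        ≤ w (-(Y ^ (q ^ 3 + 1) * ((b ^ q) ^ q + b ^ q + b))) := by
      rw [w.map_neg, w.map_mul, hYn, WithTop.coe_add]
      push_cast
      gcongr
    have hq3 : (0 : ℝ) < q ^ 3 * (q ^ 2 - 1) - (q ^ 3 + q ^ 2) := by
      nlinarith [pow_pos (show (0 : ℝ) < q by linarith) 2,
        mul_pos (pow_pos (show (0 : ℝ) < q by linarith) 2)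
          (show (0 : ℝ) < q * (q ^ 2 - 2) - 1 by nlinarith)]
    have hYb : w (Y ^ (q + 1) * b) = (((q + 1) * ε + t : ℝ) : WithTop ℝ) := by
      rw [w.map_mul, hYn, ht, ← WithTop.coe_add]; push_cast; rfl
    have hC : w c < w (-(π * (Y ^ (q + 1) * b))) := by
      rw [w.map_neg, w.map_mul, hπ, hYb, hc, ← WithTop.coe_add, WithTop.coe_lt_coe]
      have := mul_pos hq3 hε
      nlinarith
    have hE : w c < w (-(π ^ q * (Y ^ (q + 1) * b))) := by
      rw [w.map_neg, w.map_mul, w.map_pow, hπ, hYb, hc, ← WithTop.coe_nsmul, nsmul_eq_mul,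
        ← WithTop.coe_add, WithTop.coe_lt_coe]
      have h1 := mul_pos hq3 hε
      have h2 : 0 ≤ ((q : ℝ) - 1) * (q ^ 3 * (q ^ 2 - 1) * ε) := by
        have : (0 : ℝ) ≤ q ^ 2 - 1 := by nlinarith
        have : (0 : ℝ) ≤ q - 1 := by linarith
        positivity
      nlinarith
    have hD : w c < w (-(u ^ q * (Y ^ (q ^ 2 + 1) * (b ^ q + b)))) := by
      rw [w.map_neg, w.map_mul, w.map_mul, w.map_pow, hu, hYn, hc, ← WithTop.coe_nsmul,
        nsmul_eq_mul]
      refine lt_of_lt_of_le ?_ (add_le_add le_rfl (add_le_add le_rfl hb2))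
      rw [← WithTop.coe_add, ← WithTop.coe_add, WithTop.coe_lt_coe]
      push_cast
      have h1 : (0 : ℝ) ≤ q ^ 3 * (q * (q - 1) - 1) :=
        mul_nonneg (by positivity) (by nlinarith)
      have h2 := mul_nonneg h1 hε.le
      nlinarith
    have hrest := w.map_lt_add hC (w.map_lt_add hD hE)
    rw [WithTop.coe_inj]
    rcases lt_trichotomy t ((q ^ 2 - 1) * ε) with hlt | heq | hgt
    · exfalso
      have hAc : (q ^ 2 + q) * ε + q * t < (q ^ 3 + q ^ 2) * ε := by nlinarith
      have hAB : (q ^ 2 + q) * ε + q * t < (q ^ 3 + 1) * ε + t := by nlinarith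
      have hAc' : w (Y ^ (q ^ 2 + q) * b ^ q) < w c := by
        rw [hA, hc]; exact_mod_cast hAc
      have := w.map_add_eq_of_lt_left (w.map_lt_add
        (lt_of_lt_of_le (by rw [hA]; exact_mod_cast hAB) hB) (hAc'.trans hrest))
      rw [h] at this
      exact hAc'.ne' this
    · exact heq
    · exfalso
      have hAc : (q ^ 3 + q ^ 2) * ε < (q ^ 2 + q) * ε + q * t := by nlinarith
      have hBc : (q ^ 3 + q ^ 2) * ε < (q ^ 3 + 1) * ε + t := by nlinarith
      have := w.map_lt_add (by rw [hA, hc]; exact_mod_cast hAc)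
        (w.map_lt_add (lt_of_lt_of_le (by rw [hc]; exact_mod_cast hBc) hB) hrest)
      rw [h] at this
      exact this.false

/-- on the space Y^{π₂}_{3,1,c}, the function a = X₂/Y₂ satisfies
v(a) = 0 and v(a^q − a) = 1/q³ > 0; in particular the residue of a lies in F_q^×,
i.e. a is congruent (mod positive valuation) to a (q−1)-st root of unity ζ. -/
theorem stmt_7 (p f q : ℕ) (hp : p.Prime) (hf : 0 < f) (hq : q = p ^ f)
    (K : Type*) [Field K] [IsAlgClosed K] [CharP K p]
    (v : K → WithTop ℝ)
    (hv_top : ∀ x : K, v x = ⊤ ↔ x = 0)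
    (hv_mul : ∀ x y : K, v (x * y) = v x + v y)
    (hv_add : ∀ x y : K, min (v x) (v y) ≤ v (x + y))
    (π : K) (hπ : v π = 1)
    (π₁ : K) (hπ₁ : π₁ ^ (q - 1) = π)
    (π₂ : K) (hπ₂ : π * π₂ - π₂ ^ q = π₁)
    (u X₂ Y₂ X₁ Y₁ : K)
    (hX₁ : X₁ = X₂ ^ q ^ 2 + u * X₂ ^ q + π * X₂)
    (hY₁ : Y₁ = Y₂ ^ q ^ 2 + u * Y₂ ^ q + π * Y₂)
    (htorX : X₁ ^ q ^ 2 + u * X₁ ^ q + π * X₁ = 0)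
    (htorY : Y₁ ^ q ^ 2 + u * Y₁ ^ q + π * Y₁ = 0)
    (hμ₂ : X₁ * Y₂ ^ q - X₁ ^ q * Y₂ - X₂ ^ q * Y₁ + X₂ * Y₁ ^ q = π₂)
    (hu : v u = ((1 / ((q : ℝ) + 1) : ℝ) : WithTop ℝ))
    (hvX₁ : v X₁ = ((1 / ((q : ℝ) * ((q : ℝ) ^ 2 - 1)) : ℝ) : WithTop ℝ))
    (hvY₁ : v Y₁ = ((1 / ((q : ℝ) * ((q : ℝ) ^ 2 - 1)) : ℝ) : WithTop ℝ))
    (hvX₂ : v X₂ = ((1 / ((q : ℝ) ^ 3 * ((q : ℝ) ^ 2 - 1)) : ℝ) : WithTop ℝ))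
    (hvY₂ : v Y₂ = ((1 / ((q : ℝ) ^ 3 * ((q : ℝ) ^ 2 - 1)) : ℝ) : WithTop ℝ))
    (a : K) (ha : a = X₂ / Y₂) :
    v a = 0 ∧
    v (a ^ q - a) = ((1 / (q : ℝ) ^ 3 : ℝ) : WithTop ℝ) ∧
    ∃ ζ : K, ζ ^ (q - 1) = 1 ∧ 0 < v (a - ζ) := by
  have : Fact p.Prime := ⟨hp⟩
  have hq2 : 2 ≤ q := hq ▸ hp.two_le.trans (Nat.le_self_pow hf.ne' p)
  have hq2' : (2 : ℝ) ≤ q := by exact_mod_cast hq2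
  have hv1 : v 1 = 0 := by
    have h := hv_mul 1 1
    have hne : v 1 ≠ ⊤ := fun h ↦ one_ne_zero ((hv_top 1).1 h)
    rw [mul_one] at h
    lift v 1 to ℝ using hne with r
    rw [← WithTop.coe_add, WithTop.coe_inj] at h
    rw [← WithTop.coe_zero, WithTop.coe_inj]
    linarith
  let w : AddValuation K (WithTop ℝ) := AddValuation.of v ((hv_top 0).2 rfl) hv1 hv_add hv_mul
  have hwv (x : K) : v x = w x := rfl
  simp only [hwv] at hπ hu hvX₂ hvY₂ ⊢
  have hY0 : Y₂ ≠ 0 := by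
    rintro rfl
    rw [w.map_zero] at hvY₂
    exact absurd hvY₂ WithTop.top_ne_coe
  have hX : X₂ = a * Y₂ := by rw [ha, div_mul_cancel₀ _ hY0]
  have hwa : w a = 0 := by
    have h := congrArg w hX
    rw [w.map_mul, hvX₂, hvY₂] at h
    cases hr : w a with
    | top => rw [hr, top_add] at h; exact absurd h WithTop.coe_ne_top
    | coe r =>
      rw [hr, ← WithTop.coe_add, WithTop.coe_inj] at h
      have : r = 0 := by linarith
      rw [this]; rfl
  have hq1 : (0 : ℝ) < q - 1 := by linarith
  have hqq : (0 : ℝ) < q ^ 2 - 1 := by nlinarith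
  have hε : (0 : ℝ) < 1 / ((q : ℝ) ^ 3 * ((q : ℝ) ^ 2 - 1)) := by positivity
  have hfac : (q : ℝ) ^ 2 - 1 = (q - 1) * (q + 1) := by ring
  have hwb : w (a ^ q - a) = ((1 / (q : ℝ) ^ 3 : ℝ) : WithTop ℝ) := by
    have hμ := moore_two_expansion hq π u a Y₂
    rw [← hX, ← hX₁, ← hY₁, hμ₂] at hμ
    rw [map_eq_of_moore_two_expansion w hq2 hε ?_ ?_ hvY₂ ?_ ?_ hμ.symm, WithTop.coe_inj]
    · field_simp
    · rw [hπ, ← WithTop.coe_one, WithTop.coe_inj]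
      field_simp
    · rw [hu, WithTop.coe_inj, hfac]
      field_simp
    · refine le_trans ?_ (w.map_sub _ _)
      rw [w.map_pow, hwa, smul_zero, min_self]
    · rw [map_eq_of_level_two w hq2 hπ hπ₁ hπ₂, WithTop.coe_inj, hfac]
      field_simp
  refine ⟨hwa, hwb, exists_root_of_unity_near w (by omega) ?_⟩
  have hmul : a ^ q - a = a * (a ^ (q - 1) - 1) := by
    rw [mul_sub, mul_one, mul_pow_sub_one (by omega)]
  rw [hmul, w.map_mul, hwa, zero_add] at hwb
  rw [hwb]
  have : (0 : ℝ) < 1 / (q : ℝ) ^ 3 := by positivity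
  exact_mod_cast this
end

section
/- (Reduction of the space Y^{π₂}_{2,2}.) Suppose u, X₂, Y₂ ∈ K satisfy: v(u) ≥ q/(q+1), [π]_u([π]_u(X₂)) = [π]_u([π]_u(Y₂)) = 0, μ₂(X₂,Y₂) = π₂, and the valuation conditions v(X₁) = v(Y₁) = 1/(q²−1) and v(X₂) = v(Y₂) = 1/(q²(q²−1)), where X₁ = [π]_u(X₂) and Y₁ = [π]_u(Y₂). Let α ∈ K with α^{q(q+1)} = π₂ and γ₁ ∈ K with γ₁^q = α^{(q−1)(q²−1)}, and set x = X₂/α, y = Y₂/α, Z = (x^q y − x y^q − 1)/γ₁. Then v(x) = v(y) = 0, v(Z) ≥ 0, and v(Z^q − x^{q³} y + x y^{q³}) > 0; that is, the residues satisfy x̄^q ȳ − x̄ ȳ^q = 1 and Z̄^q = x̄^{q³} ȳ − x̄ ȳ^{q³}. -/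
/-- A solution of `π t - t ^ q = π₁`, where `π₁ ^ (q - 1) = π` and `v π = 1`, has valuation
`1 / (q (q - 1))`. -/
theorem AddValuation.eq_of_mul_sub_pow_eq {K : Type*} [Field K] (w : AddValuation K (WithTop ℝ))
    {q : ℕ} (hq : 2 ≤ q) {π π₁ t : K} (hπ : w π = 1) (hπ₁ : π₁ ^ (q - 1) = π)
    (ht : π * t - t ^ q = π₁) : w t = ((1 / ((q : ℝ) * ((q : ℝ) - 1)) : ℝ) : WithTop ℝ) := by
  have hq' : (2 : ℝ) ≤ q := by exact_mod_cast hq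
  have hπ₁v : w π₁ = ((1 / ((q : ℝ) - 1) : ℝ) : WithTop ℝ) := by
    have h := congrArg w hπ₁
    rw [w.map_pow, hπ] at h
    cases h' : w π₁ with
    | top =>
      rw [h'] at h
      obtain ⟨n, hn⟩ : ∃ n, q - 1 = n + 1 := ⟨q - 2, by omega⟩
      rw [hn, succ_nsmul, WithTop.add_top] at h
      exact absurd h (by simp)
    | coe r =>
      rw [h', ← WithTop.coe_nsmul, ← WithTop.coe_one, WithTop.coe_inj, nsmul_eq_mul,
        Nat.cast_sub (by omega)] at h
      rw [WithTop.coe_inj, eq_div_iff (by linarith)]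
      push_cast at h
      linarith
  have hpow : w (π * t) = 1 + w t := by rw [w.map_mul, hπ]
  cases h : w t with
  | top =>
    rw [w.top_iff] at h
    rw [h, mul_zero, zero_pow (by omega), sub_zero] at ht
    rw [← ht, w.map_zero] at hπ₁v
    exact absurd hπ₁v (by simp)
  | coe r =>
    have h1 : w (π * t) = ((1 + r : ℝ) : WithTop ℝ) := by rw [hpow, h]; rfl
    have h2 : w (t ^ q) = ((q * r : ℝ) : WithTop ℝ) := by
      rw [w.map_pow, h, ← WithTop.coe_nsmul, nsmul_eq_mul]
    have hsub := w.map_sub (π * t) (t ^ q)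
    rw [ht, h1, h2, hπ₁v, ← WithTop.coe_min, WithTop.coe_le_coe] at hsub
    have hs : 1 / ((q : ℝ) - 1) ≤ 1 := by
      rw [div_le_one (by linarith)]; linarith
    have hs0 : 0 < 1 / ((q : ℝ) - 1) := by
      apply one_div_pos.2; linarith
    have hs1 : 1 / ((q : ℝ) - 1) * (q - 1) = 1 := by
      field_simp [show (q : ℝ) - 1 ≠ 0 by linarith]
    have hlt : (q : ℝ) * r < 1 + r := by
      by_contra! hle
      rw [min_eq_left hle] at hsub
      nlinarith
    have heq : w π₁ = w (t ^ q) := by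
      rw [← ht]
      apply w.map_sub_eq_of_lt_right
      rw [h1, h2]
      exact WithTop.coe_lt_coe.2 hlt
    rw [hπ₁v, h2, WithTop.coe_inj] at heq
    rw [WithTop.coe_inj, mul_comm (q : ℝ), ← div_div, heq]
    field_simp

/-- If a positive power of `x` has finite valuation `n * r`, then `x` has valuation `r`. -/
theorem AddValuation.eq_of_pow_eq {K : Type*} [Field K] (w : AddValuation K (WithTop ℝ))
    {n : ℕ} (hn : n ≠ 0) {x : K} {r : ℝ} (h : w (x ^ n) = ((n * r : ℝ) : WithTop ℝ)) :
    w x = (r : WithTop ℝ) := by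
  cases h' : w x with
  | top =>
    rw [w.top_iff] at h'
    rw [h', zero_pow hn, w.map_zero] at h
    exact absurd h (WithTop.coe_ne_top).symm
  | coe s =>
    rw [w.map_pow, h', ← WithTop.coe_nsmul, nsmul_eq_mul, WithTop.coe_inj] at h
    rw [WithTop.coe_inj]
    exact mul_left_cancel₀ (Nat.cast_ne_zero.2 hn) h

theorem AddValuation.nonneg_of_pow_nonneg {K : Type*} [Field K]
    (w : AddValuation K (WithTop ℝ)) {n : ℕ} (hn : n ≠ 0) {x : K} (h : 0 ≤ w (x ^ n)) :
    0 ≤ w x := by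
  by_contra! hlt
  cases h' : w x with
  | top => simp [h'] at hlt
  | coe s =>
    rw [h', ← WithTop.coe_zero, WithTop.coe_lt_coe] at hlt
    rw [w.map_pow, h', ← WithTop.coe_nsmul, nsmul_eq_mul, ← WithTop.coe_zero,
      WithTop.coe_le_coe] at h
    have : (0 : ℝ) < n := by positivity
    nlinarith

/-- The valuation of `c * (X ^ m * Y ^ n - X ^ n * Y ^ m)` when `X` and `Y` have valuation `a`. -/
theorem AddValuation.lt_map_mul_sub {K : Type*} [Field K] (w : AddValuation K (WithTop ℝ))
    {X Y c : K} {a b s : ℝ} (hX : w X = (a : WithTop ℝ)) (hY : w Y = (a : WithTop ℝ))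
    (hc : (b : WithTop ℝ) ≤ w c) (m n : ℕ) (hs : s < b + (m + n) * a) :
    (s : WithTop ℝ) < w (c * (X ^ m * Y ^ n - X ^ n * Y ^ m)) := by
  have h1 (i j : ℕ) : w (X ^ i * Y ^ j) = (((i + j) * a : ℝ) : WithTop ℝ) := by
    rw [w.map_mul, w.map_pow, w.map_pow, hX, hY, ← WithTop.coe_nsmul, ← WithTop.coe_nsmul,
      ← WithTop.coe_add, nsmul_eq_mul, nsmul_eq_mul, add_mul]
  have h2 : (((m + n) * a : ℝ) : WithTop ℝ) ≤ w (X ^ m * Y ^ n - X ^ n * Y ^ m) :=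
    w.map_le_sub (h1 m n).ge (by rw [h1, add_comm (n : ℝ)])
  rw [w.map_mul]
  refine lt_of_lt_of_le (WithTop.coe_lt_coe.2 hs) ?_
  rw [WithTop.coe_add]
  exact add_le_add hc h2

/-- reduction of the space Y^{π₂}_{2,2}. With x = X₂/α, y = Y₂/α
(α^{q(q+1)} = π₂) and Z = (x^q y − x y^q − 1)/γ₁ (γ₁^q = α^{(q−1)(q²−1)}), one has
v(x) = v(y) = 0, v(Z) ≥ 0, and the residues satisfy x^q y − x y^q = 1 and
Z^q = x^{q³} y − x y^{q³}. -/
theorem stmt_8 (p f q : ℕ) (hp : p.Prime) (hf : 0 < f) (hq : q = p ^ f)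
    (K : Type*) [Field K] [IsAlgClosed K] [CharP K p]
    (v : K → WithTop ℝ)
    (hv_top : ∀ x : K, v x = ⊤ ↔ x = 0)
    (hv_mul : ∀ x y : K, v (x * y) = v x + v y)
    (hv_add : ∀ x y : K, min (v x) (v y) ≤ v (x + y))
    (π : K) (hπ : v π = 1)
    (π₁ : K) (hπ₁ : π₁ ^ (q - 1) = π)
    (π₂ : K) (hπ₂ : π * π₂ - π₂ ^ q = π₁)
    (u X₂ Y₂ X₁ Y₁ : K)
    (hX₁ : X₁ = X₂ ^ q ^ 2 + u * X₂ ^ q + π * X₂)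
    (hY₁ : Y₁ = Y₂ ^ q ^ 2 + u * Y₂ ^ q + π * Y₂)
    (htorX : X₁ ^ q ^ 2 + u * X₁ ^ q + π * X₁ = 0)
    (htorY : Y₁ ^ q ^ 2 + u * Y₁ ^ q + π * Y₁ = 0)
    (hμ₂ : X₁ * Y₂ ^ q - X₁ ^ q * Y₂ - X₂ ^ q * Y₁ + X₂ * Y₁ ^ q = π₂)
    (hu : (((q : ℝ) / ((q : ℝ) + 1) : ℝ) : WithTop ℝ) ≤ v u)
    (hvX₁ : v X₁ = ((1 / ((q : ℝ) ^ 2 - 1) : ℝ) : WithTop ℝ))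
    (hvY₁ : v Y₁ = ((1 / ((q : ℝ) ^ 2 - 1) : ℝ) : WithTop ℝ))
    (hvX₂ : v X₂ = ((1 / ((q : ℝ) ^ 2 * ((q : ℝ) ^ 2 - 1)) : ℝ) : WithTop ℝ))
    (hvY₂ : v Y₂ = ((1 / ((q : ℝ) ^ 2 * ((q : ℝ) ^ 2 - 1)) : ℝ) : WithTop ℝ))
    (α : K) (hα : α ^ (q * (q + 1)) = π₂)
    (γ₁ : K) (hγ₁ : γ₁ ^ q = α ^ ((q - 1) * (q ^ 2 - 1)))
    (x y Z : K) (hx : x = X₂ / α) (hy : y = Y₂ / α)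
    (hZ : Z = (x ^ q * y - x * y ^ q - 1) / γ₁) :
    v x = 0 ∧ v y = 0 ∧ 0 ≤ v Z ∧
    0 < v (Z ^ q - x ^ q ^ 3 * y + x * y ^ q ^ 3) := by
  have : Fact p.Prime := ⟨hp⟩
  have hq2 : 2 ≤ q := hq ▸ hp.two_le.trans (Nat.le_self_pow hf.ne' p)
  have hq' : (2 : ℝ) ≤ q := by exact_mod_cast hq2
  have hq0 : q ≠ 0 := by omega
  have hv1 : v 1 = 0 := by
    have h := hv_mul 1 1
    rw [mul_one] at h
    cases h' : v 1 with
    | top => exact absurd ((hv_top 1).1 h') one_ne_zero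
    | coe r =>
      rw [h', ← WithTop.coe_add, WithTop.coe_inj] at h
      rw [← WithTop.coe_zero, WithTop.coe_inj]
      linarith
  obtain ⟨w, hw⟩ : ∃ w : AddValuation K (WithTop ℝ), ∀ z, w z = v z :=
    ⟨AddValuation.of v ((hv_top 0).2 rfl) hv1 hv_add hv_mul, fun _ => rfl⟩
  simp only [← hw] at *
  set a : ℝ := 1 / ((q : ℝ) ^ 2 * ((q : ℝ) ^ 2 - 1)) with ha
  have hq1 : (q : ℝ) ^ 2 - 1 ≠ 0 := by nlinarith
  have hq1' : (q : ℝ) - 1 ≠ 0 := by linarith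
  have hπ₂v := w.eq_of_mul_sub_pow_eq hq2 hπ hπ₁ hπ₂
  have hαv : w α = (a : WithTop ℝ) := by
    apply w.eq_of_pow_eq (n := q * (q + 1)) (by positivity)
    rw [hα, hπ₂v, WithTop.coe_inj, ha, show (q : ℝ) ^ 2 - 1 = (q - 1) * (q + 1) by ring]
    push_cast
    field_simp
  have hα0 : α ≠ 0 := by
    rintro rfl
    rw [w.map_zero] at hαv
    exact absurd hαv (by simp)
  have hγ0 : γ₁ ^ q ≠ 0 := hγ₁ ▸ pow_ne_zero _ hα0
  have hXx : X₂ = α * x := by rw [hx]; field_simp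
  have hYy : Y₂ = α * y := by rw [hy]; field_simp
  have unit_of_mul {X z : K} (hX : w X = (a : WithTop ℝ)) (hz : X = α * z) : w z = 0 := by
    rw [hz, w.map_mul, hαv] at hX
    cases h : w z with
    | top => rw [h, WithTop.add_top] at hX; exact absurd hX (by simp)
    | coe r =>
      rw [h, ← WithTop.coe_add, WithTop.coe_inj] at hX
      rw [← WithTop.coe_zero, WithTop.coe_inj]
      linarith
  have hxv := unit_of_mul hvX₂ hXx
  have hyv := unit_of_mul hvY₂ hYy
  have hadd (s t : K) : (s + t) ^ q = s ^ q + t ^ q := by rw [hq]; exact add_pow_char_pow s t p f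
  have hsub (s t : K) : (s - t) ^ q = s ^ q - t ^ q := by rw [hq]; exact sub_pow_char_pow s t f
  have hZq : γ₁ ^ q * Z ^ q = γ₁ ^ q * (γ₁ ^ q)⁻¹ * (x ^ q ^ 2 * y ^ q - x ^ q * y ^ q ^ 2 - 1) := by
    rw [hZ, div_pow, hsub, hsub, mul_pow, mul_pow, one_pow, ← pow_mul, ← pow_mul, ← sq]
    ring
  rw [mul_inv_cancel₀ hγ0, one_mul] at hZq
  have hexp : q * (q + 1) + (q - 1) * (q ^ 2 - 1) = q ^ 3 + 1 := by
    have h : 1 ≤ q ^ 2 := Nat.one_le_pow _ _ (by omega)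
    zify [h, show 1 ≤ q by omega]
    ring
  have hG : π₂ * γ₁ ^ q = α ^ (q ^ 3 + 1) := by rw [hγ₁, ← hα, ← pow_add, hexp]
  have hXq : X₁ ^ q = X₂ ^ q ^ 3 + u ^ q * X₂ ^ q ^ 2 + π ^ q * X₂ ^ q := by
    rw [hX₁, hadd, hadd, mul_pow, mul_pow]; ring
  have hYq : Y₁ ^ q = Y₂ ^ q ^ 3 + u ^ q * Y₂ ^ q ^ 2 + π ^ q * Y₂ ^ q := by
    rw [hY₁, hadd, hadd, mul_pow, mul_pow]; ring
  set E := Z ^ q - x ^ q ^ 3 * y + x * y ^ q ^ 3 with hE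
  have key : α ^ (q ^ 3 + 1) * E =
      π * (X₂ ^ q * Y₂ ^ 1 - X₂ ^ 1 * Y₂ ^ q) + u ^ q * (X₂ ^ q ^ 2 * Y₂ ^ 1 - X₂ ^ 1 * Y₂ ^ q ^ 2)
        + π ^ q * (X₂ ^ q * Y₂ ^ 1 - X₂ ^ 1 * Y₂ ^ q) := by
    have h1 : α ^ (q ^ 3 + 1) * Z ^ q = X₂ ^ q ^ 2 * Y₂ ^ q - X₂ ^ q * Y₂ ^ q ^ 2 - π₂ := by
      rw [← hG, mul_assoc, hZq, ← hα, hXx, hYy]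
      ring
    have h2 : α ^ (q ^ 3 + 1) * (x ^ q ^ 3 * y - x * y ^ q ^ 3) =
        X₂ ^ q ^ 3 * Y₂ - X₂ * Y₂ ^ q ^ 3 := by
      rw [hXx, hYy]; ring
    rw [hXq, hYq, hX₁, hY₁] at hμ₂
    linear_combination h1 - h2 + hμ₂
  have hπq : w (π ^ q) = ((q : ℝ) : WithTop ℝ) := by
    rw [w.map_pow, hπ, nsmul_one]; rfl
  have huq : (((q : ℝ) * (q / (q + 1)) : ℝ) : WithTop ℝ) ≤ w (u ^ q) := by
    rw [w.map_pow, ← nsmul_eq_mul, WithTop.coe_nsmul]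
    exact nsmul_le_nsmul_right hu q
  have hcube : ((q : ℝ) ^ 3 - q) * a = 1 / q := by
    rw [ha]; field_simp
  have hcube' : ((q : ℝ) ^ 3 - q ^ 2) * a = 1 / (q + 1) := by
    rw [ha, show (q : ℝ) ^ 2 - 1 = (q - 1) * (q + 1) by ring]; field_simp
  have hinv : 1 / (q : ℝ) < 1 := by rw [div_lt_one (by linarith)]; linarith
  have hinv' : 1 / ((q : ℝ) + 1) < q * (q / (q + 1)) := by
    rw [← mul_div_assoc]; gcongr; nlinarith
  have hlt : ((((q : ℝ) ^ 3 + 1) * a : ℝ) : WithTop ℝ) < w (α ^ (q ^ 3 + 1) * E) := by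
    rw [key]
    refine w.map_lt_add (w.map_lt_add ?_ ?_) ?_
    · refine w.lt_map_mul_sub hvX₂ hvY₂ (b := 1) (by rw [hπ]; rfl) q 1 ?_
      push_cast
      linarith
    · refine w.lt_map_mul_sub hvX₂ hvY₂ huq (q ^ 2) 1 ?_
      push_cast
      linarith
    · refine w.lt_map_mul_sub hvX₂ hvY₂ hπq.ge q 1 ?_
      push_cast
      linarith
  have hEv : 0 < w E := by
    by_contra! hle
    rw [w.map_mul, w.map_pow, hαv, ← WithTop.coe_nsmul, nsmul_eq_mul] at hlt
    push_cast at hlt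
    have := hlt.trans_le (add_le_add_right hle _)
    rw [add_zero] at this
    exact lt_irrefl _ this
  refine ⟨hxv, hyv, w.nonneg_of_pow_nonneg hq0 ?_, hEv⟩
  have hmon (m n : ℕ) : 0 ≤ w (x ^ m * y ^ n) := by
    rw [w.map_mul, w.map_pow, w.map_pow, hxv, hyv]; simp
  rw [show Z ^ q = E + (x ^ q ^ 3 * y ^ 1 - x ^ 1 * y ^ q ^ 3) by rw [hE]; ring]
  exact w.map_le_add hEv.le (w.map_le_sub (hmon _ _) (hmon _ _))
end

section
/- (Singular locus of the reduction of Y^{π₂}_{2,2}.) Let k be an algebraically closed field of characteristic p and q = p^f. Let f₁ = x^q y − x y^q − 1 and f₂ = Z^q − x^{q³} y + x y^{q³} in k[x, y, Z]. Then the set S of points P = (x, y, Z) ∈ k³ with f₁(P) = f₂(P) = 0 at which the 2×3 Jacobian matrix of (f₁, f₂) with respect to (x, y, Z) has rank strictly less than 2 is exactly the set of points of the form (ζ t, t, Z) where ζ ∈ k satisfies ζ^{q²} = ζ and ζ^q ≠ ζ, t ∈ k satisfies t^{q+1} = 1/(ζ^q − ζ), and Z is the unique element with Z^q = (ζ t)^{q³}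 t − (ζ t) t^{q³}. In particular S has cardinality q(q²−1). -/
open MvPolynomial

theorem rank_lt_two_iff_of_last_column_eq_zero {k : Type*} [Field k]
    (A : Matrix (Fin 2) (Fin 3) k) (h0 : A 0 2 = 0) (h1 : A 1 2 = 0) :
    A.rank < 2 ↔ A 0 0 * A 1 1 - A 0 1 * A 1 0 = 0 := by
  have key : A.rank < 2 ↔ ¬ LinearIndependent k A.row := by
    rw [← not_iff_not, not_not, not_lt]
    constructor
    · intro h
      rw [linearIndependent_iff_card_eq_finrank_span, Set.finrank, ← A.rank_eq_finrank_span_row]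
      exact le_antisymm (by simpa using h) (by simpa using A.rank_le_card_height)
    · intro h
      simp [h.rank_matrix]
  have hrow : A.row = ![A 0, A 1] := by
    ext i j
    fin_cases i <;> rfl
  rw [key, hrow, LinearIndependent.pair_iff]
  constructor
  · intro h
    by_contra hd
    refine h fun s t hst => ?_
    have e0 : s * A 0 0 + t * A 1 0 = 0 := by simpa using congrFun hst 0
    have e1 : s * A 0 1 + t * A 1 1 = 0 := by simpa using congrFun hst 1
    exact ⟨(mul_eq_zero.1 (by linear_combination A 1 1 * e0 - A 1 0 * e1 :
        s * (A 0 0 * A 1 1 - A 0 1 * A 1 0) = 0)).resolve_right hd,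
      (mul_eq_zero.1 (by linear_combination A 0 0 * e1 - A 0 1 * e0 :
        t * (A 0 0 * A 1 1 - A 0 1 * A 1 0) = 0)).resolve_right hd⟩
  · intro hd h
    have hc0 := h (A 1 0) (-A 0 0) (by
      ext j
      fin_cases j
      · simp; ring
      · simp; linear_combination -hd
      · simp [h0, h1])
    have hc1 := h (A 1 1) (-A 0 1) (by
      ext j
      fin_cases j
      · simp; linear_combination hd
      · simp; ring
      · simp [h0, h1])
    have := h 1 0 (by
      ext j
      fin_cases j
      · simpa using hc0.2
      · simpa using hc1.2
      · simp [h0])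
    exact one_ne_zero this.1

theorem card_toFinset_roots_of_separable {k : Type*} [Field k] [IsAlgClosed k] [DecidableEq k]
    {g : Polynomial k} (hg : g.Separable) : g.roots.toFinset.card = g.natDegree := by
  rw [Multiset.toFinset_card_of_nodup (Polynomial.nodup_roots hg)]
  exact (IsAlgClosed.splits g).natDegree_eq_card_roots.symm

theorem exists_finset_pow_eq_self {k : Type*} [Field k] [IsAlgClosed k] (p n : ℕ) [CharP k p]
    (hn : 1 < n) (hpn : p ∣ n) :
    ∃ F : Finset k, F.card = n ∧ ∀ x, x ∈ F ↔ x ^ n = x := by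
  classical
  refine ⟨(Polynomial.X ^ n - Polynomial.X : Polynomial k).roots.toFinset, ?_, fun x => ?_⟩
  · rw [card_toFinset_roots_of_separable (galois_poly_separable p n hpn),
      FiniteField.X_pow_card_sub_X_natDegree_eq k hn]
  · rw [Multiset.mem_toFinset, Polynomial.mem_roots (FiniteField.X_pow_card_sub_X_ne_zero k hn)]
    simp [Polynomial.IsRoot, sub_eq_zero]

theorem exists_finset_pow_eq {k : Type*} [Field k] [IsAlgClosed k] (n : ℕ)
    (hn : (n : k) ≠ 0) (c : k) (hc : c ≠ 0) :
    ∃ F : Finset k, F.card = n ∧ ∀ x, x ∈ F ↔ x ^ n = c := by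
  classical
  have hn0 : 0 < n := Nat.pos_of_ne_zero (by rintro rfl; simp at hn)
  refine ⟨(Polynomial.X ^ n - Polynomial.C c).roots.toFinset, ?_, fun x => ?_⟩
  · rw [card_toFinset_roots_of_separable (Polynomial.separable_X_pow_sub_C c hn hc),
      Polynomial.natDegree_X_pow_sub_C]
  · rw [Multiset.mem_toFinset, Polynomial.mem_roots (Polynomial.X_pow_sub_C_ne_zero hn0 c)]
    simp [Polynomial.IsRoot, sub_eq_zero]

theorem exists_finset_pow_sq_eq_self_and_pow_ne {k : Type*} [Field k] [IsAlgClosed k]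
    (p q : ℕ) [CharP k p] (hq : 1 < q) (hpq : p ∣ q) :
    ∃ F : Finset k, F.card = q ^ 2 - q ∧ ∀ x, x ∈ F ↔ x ^ q ^ 2 = x ∧ x ^ q ≠ x := by
  classical
  obtain ⟨F₁, hc₁, hm₁⟩ := exists_finset_pow_eq_self (k := k) p q hq hpq
  obtain ⟨F₂, hc₂, hm₂⟩ := exists_finset_pow_eq_self (k := k) p (q ^ 2)
    (Nat.one_lt_pow two_ne_zero hq) (hpq.trans (dvd_pow_self q two_ne_zero))
  refine ⟨F₂ \ F₁, ?_, fun x => by simp [hm₁, hm₂]⟩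
  rw [Finset.card_sdiff_of_subset, hc₁, hc₂]
  intro x hx
  rw [hm₁] at hx
  rw [hm₂, pow_two, pow_mul, hx, hx]

/-- The points `(ζ t, t, Z)` are counted by first choosing `ζ`, then `t`, then `Z`. -/
theorem ncard_pow_sq_eq_self_points {k : Type*} [Field k] [IsAlgClosed k] (p q : ℕ) [CharP k p]
    (hq : 1 < q) (hpq : p ∣ q) (hinj : Function.Injective fun x : k => x ^ q) (G : k → k → k) :
    {P : Fin 3 → k | ∃ ζ t : k, ζ ^ q ^ 2 = ζ ∧ ζ ^ q ≠ ζ ∧ t ^ (q + 1) = (ζ ^ q - ζ)⁻¹ ∧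
      P 0 = ζ * t ∧ P 1 = t ∧ P 2 ^ q = G ζ t}.ncard = q * (q ^ 2 - 1) := by
  classical
  have hq0 : (q : k) = 0 := (CharP.cast_eq_zero_iff k p q).2 hpq
  obtain ⟨A, hAc, hA⟩ := exists_finset_pow_sq_eq_self_and_pow_ne (k := k) p q hq hpq
  have hB : ∀ ζ ∈ A, ∃ B : Finset k, B.card = q + 1 ∧
      ∀ t, t ∈ B ↔ t ^ (q + 1) = (ζ ^ q - ζ)⁻¹ := fun ζ hζ =>
    exists_finset_pow_eq (q + 1) (by simp [hq0]) _ (inv_ne_zero (sub_ne_zero.2 ((hA ζ).1 hζ).2))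
  choose! B hBc hBm using hB
  choose r hr using fun a : k => IsAlgClosed.exists_pow_nat_eq a (zero_lt_one.trans hq)
  let g : (Σ _ : k, k) → Fin 3 → k := fun s => ![s.1 * s.2, s.2, r (G s.1 s.2)]
  have himage : {P : Fin 3 → k | ∃ ζ t : k, ζ ^ q ^ 2 = ζ ∧ ζ ^ q ≠ ζ ∧
      t ^ (q + 1) = (ζ ^ q - ζ)⁻¹ ∧ P 0 = ζ * t ∧ P 1 = t ∧ P 2 ^ q = G ζ t} =
      g '' (A.sigma B : Finset (Σ _ : k, k)) := by
    ext P
    constructor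
    · rintro ⟨ζ, t, h1, h2, h3, h4, h5, h6⟩
      have hζ : ζ ∈ A := (hA ζ).2 ⟨h1, h2⟩
      refine ⟨⟨ζ, t⟩, by simp [hζ, hBm ζ hζ, h3], ?_⟩
      ext j
      fin_cases j
      · simp [g, h4]
      · simp [g, h5]
      · exact hinj (by simp [g, hr, h6])
    · rintro ⟨⟨ζ, t⟩, hs, rfl⟩
      obtain ⟨hζ, ht⟩ := Finset.mem_sigma.1 (Finset.mem_coe.1 hs)
      exact ⟨ζ, t, ((hA ζ).1 hζ).1, ((hA ζ).1 hζ).2, (hBm ζ hζ t).1 ht, rfl, rfl, hr _⟩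
  have hg : Set.InjOn g (A.sigma B : Finset (Σ _ : k, k)) := by
    rintro ⟨ζ, t⟩ hs ⟨ζ', t'⟩ - h
    obtain ⟨hζ, ht⟩ := Finset.mem_sigma.1 (Finset.mem_coe.1 hs)
    have ht0 : t ≠ 0 := by
      rintro rfl
      have := (hBm ζ hζ 0).1 ht
      rw [zero_pow q.succ_ne_zero] at this
      exact inv_ne_zero (sub_ne_zero.2 ((hA ζ).1 hζ).2) this.symm
    have e0 : ζ * t = ζ' * t' := congrFun h 0
    have e1 : t = t' := congrFun h 1
    subst e1
    rw [mul_right_cancel₀ ht0 e0]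
  rw [himage, hg.ncard_image, Set.ncard_coe_finset, Finset.card_sigma,
    Finset.sum_congr rfl hBc, Finset.sum_const, hAc, smul_eq_mul]
  have h1 : q ≤ q ^ 2 := Nat.le_self_pow two_ne_zero q
  have h2 : 1 ≤ q ^ 2 := Nat.one_le_pow _ _ (zero_lt_one.trans hq)
  zify [h1, h2]
  ring

theorem sub_eq_one_and_pow_sq_mul_eq_iff {k : Type*} [Field k] {q : ℕ} (hq : q ≠ 0) (x y : k) :
    x ^ q * y - x * y ^ q = 1 ∧ x ^ q ^ 2 * y = x * y ^ q ^ 2 ↔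
      ∃ ζ, ζ ^ q ^ 2 = ζ ∧ ζ ^ q ≠ ζ ∧ y ^ (q + 1) = (ζ ^ q - ζ)⁻¹ ∧ x = ζ * y := by
  constructor
  · rintro ⟨h1, h2⟩
    have hy : y ≠ 0 := by
      rintro rfl
      simp [zero_pow hq] at h1
    obtain ⟨ζ, rfl⟩ : ∃ ζ, x = ζ * y := ⟨x / y, (div_mul_cancel₀ x hy).symm⟩
    have h3 : y ^ (q + 1) * (ζ ^ q - ζ) = 1 := by
      rw [← h1]
      ring
    refine ⟨ζ, ?_, ?_, eq_inv_of_mul_eq_one_left h3, rfl⟩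
    · rw [mul_pow] at h2
      exact mul_right_cancel₀ (mul_ne_zero (pow_ne_zero (q ^ 2) hy) hy)
        (by linear_combination h2)
    · intro h
      simp [h] at h3
  · rintro ⟨ζ, h1, h2, h3, rfl⟩
    have h4 : y ^ (q + 1) * (ζ ^ q - ζ) = 1 := by
      rw [h3, inv_mul_cancel₀ (sub_ne_zero.2 h2)]
    exact ⟨by rw [← h4]; ring, by rw [mul_pow, h1]; ring⟩

/-- singular locus of the reduction of Y^{π₂}_{2,2}, the affine curve
x^q y − x y^q = 1, Z^q = x^{q³} y − x y^{q³} in 𝔸³ (coordinates P 0 = x, P 1 = y,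
P 2 = Z). The singular points (where the Jacobian of (f₁,f₂) has rank < 2) are
exactly the q(q²−1) points (ζt, t, Z) with ζ ∈ F_{q²} \ F_q, t^{q+1} = 1/(ζ^q − ζ),
and Z^q = (ζt)^{q³} t − (ζt) t^{q³}. -/
theorem stmt_9 (p f q : ℕ) (hp : p.Prime) (hf : 0 < f) (hq : q = p ^ f)
    (k : Type*) [Field k] [IsAlgClosed k] [CharP k p]
    (f₁ f₂ : MvPolynomial (Fin 3) k)
    (hf₁ : f₁ = X 0 ^ q * X 1 - X 0 * X 1 ^ q - 1)
    (hf₂ : f₂ = X 2 ^ q - X 0 ^ q ^ 3 * X 1 + X 0 * X 1 ^ q ^ 3)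
    (S : Set (Fin 3 → k))
    (hS : S = {P | eval P f₁ = 0 ∧ eval P f₂ = 0 ∧
      (Matrix.of fun (i : Fin 2) (j : Fin 3) =>
        eval P (pderiv j (![f₁, f₂] i))).rank < 2}) :
    S = {P | ∃ ζ t : k, ζ ^ q ^ 2 = ζ ∧ ζ ^ q ≠ ζ ∧
        t ^ (q + 1) = (ζ ^ q - ζ)⁻¹ ∧
        P 0 = ζ * t ∧ P 1 = t ∧
        (P 2) ^ q = (ζ * t) ^ q ^ 3 * t - (ζ * t) * t ^ q ^ 3} ∧
    S.ncard = q * (q ^ 2 - 1) := by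
  have : Fact p.Prime := ⟨hp⟩
  have hpq : p ∣ q := hq ▸ dvd_pow_self p hf.ne'
  have hq1 : 1 < q := hq ▸ Nat.one_lt_pow hf.ne' hp.one_lt
  have hq0 : (q : k) = 0 := (CharP.cast_eq_zero_iff k p q).2 hpq
  have hinj : Function.Injective fun x : k => x ^ q := by
    subst hq
    exact iterateFrobenius_inj k p f
  have hjac : ∀ P : Fin 3 → k, (Matrix.of fun (i : Fin 2) (j : Fin 3) =>
      eval P (pderiv j (![f₁, f₂] i))).rank < 2 ↔
      P 0 ^ q ^ 2 * P 1 = P 0 * P 1 ^ q ^ 2 := by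
    intro P
    rw [rank_lt_two_iff_of_last_column_eq_zero]
    · simp [hf₁, hf₂, pderiv_X, hq0]
      refine Iff.trans ?_ hinj.eq_iff
      have hpow : ∀ a : k, (a ^ q ^ 2) ^ q = a ^ q ^ 3 := fun a => by rw [← pow_mul, ← pow_succ]
      simp only [mul_pow, hpow]
      constructor <;> intro h <;> linear_combination h
    · simp [hf₁, pderiv_X]
    · simp [hf₂, pderiv_X, hq0]
  have hSeq : S = {P | ∃ ζ t : k, ζ ^ q ^ 2 = ζ ∧ ζ ^ q ≠ ζ ∧
        t ^ (q + 1) = (ζ ^ q - ζ)⁻¹ ∧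
        P 0 = ζ * t ∧ P 1 = t ∧
        (P 2) ^ q = (ζ * t) ^ q ^ 3 * t - (ζ * t) * t ^ q ^ 3} := by
    ext P
    have h1 : eval P f₁ = 0 ↔ P 0 ^ q * P 1 - P 0 * P 1 ^ q = 1 := by
      simp [hf₁, sub_eq_zero]
    have h2 : eval P f₂ = 0 ↔ P 2 ^ q = P 0 ^ q ^ 3 * P 1 - P 0 * P 1 ^ q ^ 3 := by
      simp only [hf₂, map_add, map_sub, map_mul, map_pow, eval_X]
      constructor <;> intro h <;> linear_combination h
    rw [hS, Set.mem_ofPred_eq, hjac, h1, h2, and_left_comm,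
      sub_eq_one_and_pow_sq_mul_eq_iff (zero_lt_one.trans hq1).ne']
    constructor
    · rintro ⟨hZ, ζ, a, b, c, d⟩
      exact ⟨ζ, P 1, a, b, c, d, rfl, d ▸ hZ⟩
    · rintro ⟨ζ, t, a, b, c, d, rfl, hZ⟩
      exact ⟨d ▸ hZ, ζ, a, b, c, d⟩
  refine ⟨hSeq, ?_⟩
  rw [hSeq]
  exact ncard_pow_sq_eq_self_points p q hq1 hpq hinj
    fun ζ t => (ζ * t) ^ q ^ 3 * t - (ζ * t) * t ^ q ^ 3
end

section
/- (Reduction of the space Z^{π₂}_{1,1,e₁}.) Suppose u, X₂, Y₂ ∈ K satisfy: v(u) = 1/2, [π]_u([π]_u(X₂)) = [π]_u([π]_u(Y₂)) = 0, μ₂(X₂,Y₂) = π₂, and the valuation conditions v(X₁) = 1/(2(q−1)), v(X₂) = 1/(2q²(q−1)), v(Y₁) = 1/(2q(q−1)), v(Y₂) = 1/(2q³(q−1)), where X₁ = [π]_u(X₂) and Y₁ = [π]_u(Y₂). Let α ∈ K with α^{2q²} = π₂ and γ₂ ∈ K with γ₂^{q²} = α^{q(q−1)²}; set γ₁ = γ₂^q,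 x = X₂/α^q, y = Y₂/α, Z = (1 + x y^q)/γ₁, and Z₁ = (Z + y^{q²−1} + y^{−(q²−1)})/(γ₂ y^{q²−1}). Then v(x) = v(y) = 0, v(Z) ≥ 0, v(Z₁) ≥ 0, and v(Z₁^q + y^{q²−1} + y^{−(q²−1)}) > 0; that is, the residues satisfy Z̄₁^q + ȳ^{q²−1} + 1/ȳ^{q²−1} = 0. -/
namespace AddValuation

variable {K : Type*} [Field K] (v : AddValuation K (WithTop ℝ))

theorem map_mul_of_eq_coe {x y : K} {a b : ℝ} (hx : v x = (a : WithTop ℝ))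
    (hy : v y = (b : WithTop ℝ)) : v (x * y) = ((a + b : ℝ) : WithTop ℝ) := by
  rw [v.map_mul, hx, hy, WithTop.coe_add]

theorem map_pow_of_eq_coe_s12 {x : K} {a : ℝ} (hx : v x = (a : WithTop ℝ)) (n : ℕ) :
    v (x ^ n) = ((n * a : ℝ) : WithTop ℝ) := by
  rw [v.map_pow, hx, ← WithTop.coe_nsmul, nsmul_eq_mul]

theorem ne_zero_of_eq_coe {x : K} {a : ℝ} (hx : v x = (a : WithTop ℝ)) : x ≠ 0 := by
  rintro rfl
  simp at hx

theorem exists_eq_coe_of_ne_zero {x : K} (hx : x ≠ 0) : ∃ a : ℝ, v x = (a : WithTop ℝ) := by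
  obtain ⟨a, ha⟩ := WithTop.ne_top_iff_exists.mp (v.ne_top_iff.mpr hx)
  exact ⟨a, ha.symm⟩

theorem map_div_of_eq_coe {x y : K} {a b : ℝ} (hx : v x = (a : WithTop ℝ))
    (hy : v y = (b : WithTop ℝ)) : v (x / y) = ((a - b : ℝ) : WithTop ℝ) := by
  have hy0 := v.ne_zero_of_eq_coe hy
  obtain ⟨d, hd⟩ := v.exists_eq_coe_of_ne_zero (div_ne_zero (v.ne_zero_of_eq_coe hx) hy0)
  have h := v.map_mul_of_eq_coe hd hy
  rw [div_mul_cancel₀ _ hy0, hx, WithTop.coe_inj] at h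
  rw [hd, h, add_sub_cancel_right]

theorem eq_coe_of_map_pow_s12 {x : K} {a : ℝ} {n : ℕ} (hn : n ≠ 0)
    (h : v (x ^ n) = (a : WithTop ℝ)) : v x = ((a / n : ℝ) : WithTop ℝ) := by
  have hx : x ≠ 0 := by
    rintro rfl
    simp [hn] at h
  obtain ⟨b, hb⟩ := v.exists_eq_coe_of_ne_zero hx
  have h' := v.map_pow_of_eq_coe_s12 hb n
  rw [h, WithTop.coe_inj] at h'
  have : (n : ℝ) ≠ 0 := Nat.cast_ne_zero.mpr hn
  rw [hb, h', mul_div_cancel_left₀ _ this]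

theorem nonneg_of_map_pow {x : K} {n : ℕ} (hn : n ≠ 0) (h : 0 ≤ v (x ^ n)) : 0 ≤ v x := by
  by_cases hx : x = 0
  · simp [hx]
  obtain ⟨b, hb⟩ := v.exists_eq_coe_of_ne_zero hx
  rw [v.map_pow_of_eq_coe_s12 hb, WithTop.coe_nonneg] at h
  rw [hb, WithTop.coe_nonneg]
  have : (0 : ℝ) < n := Nat.cast_pos.mpr (Nat.pos_of_ne_zero hn)
  exact nonneg_of_mul_nonneg_right h this

theorem pos_div {x y : K} {b : ℝ} (hx : (b : WithTop ℝ) < v x)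
    (hy : v y = (b : WithTop ℝ)) : 0 < v (x / y) := by
  by_cases h0 : x = 0
  · simp [h0]
  obtain ⟨a, ha⟩ := v.exists_eq_coe_of_ne_zero h0
  rw [ha, WithTop.coe_lt_coe] at hx
  rw [v.map_div_of_eq_coe ha hy, WithTop.coe_pos]
  linarith

theorem lt_map_sub {x y : K} {a : WithTop ℝ} (hx : a < v x) (hy : a < v y) : a < v (x - y) := by
  rw [sub_eq_add_neg]
  exact v.map_lt_add hx (by rwa [v.map_neg])

theorem nonneg_add {x y : K} (hx : 0 ≤ v x) (hy : 0 ≤ v y) : 0 ≤ v (x + y) :=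
  v.map_le_add hx hy

theorem nonneg_mul {x y : K} (hx : 0 ≤ v x) (hy : 0 ≤ v y) : 0 ≤ v (x * y) := by
  rw [v.map_mul]
  exact add_nonneg hx hy

theorem nonneg_pow {x : K} (hx : 0 ≤ v x) (n : ℕ) : 0 ≤ v (x ^ n) := by
  rw [v.map_pow]
  exact nsmul_nonneg hx n

theorem pos_mul {x y : K} (hx : 0 < v x) (hy : 0 ≤ v y) : 0 < v (x * y) := by
  rw [v.map_mul]
  exact add_pos_of_pos_of_nonneg hx hy

/-- The valuation of a root of the equation `π t - t ^ q = π₁`. -/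
theorem eq_coe_of_mul_sub_pow {π π₁ t : K} {q : ℕ} (hq : 2 ≤ q) (hπ : v π = 1)
    (hπ₁ : v π₁ = ((1 / ((q : ℝ) - 1) : ℝ) : WithTop ℝ)) (h : π * t - t ^ q = π₁) :
    v t = ((1 / ((q : ℝ) * ((q : ℝ) - 1)) : ℝ) : WithTop ℝ) := by
  have hq' : (2 : ℝ) ≤ q := by exact_mod_cast hq
  have hq1 : (0 : ℝ) < (q : ℝ) - 1 := by linarith
  have ht : t ≠ 0 := by
    rintro rfl
    have hq0 : q ≠ 0 := by omega
    apply v.ne_zero_of_eq_coe hπ₁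
    rw [← h]
    simp [hq0]
  obtain ⟨a, ha⟩ := v.exists_eq_coe_of_ne_zero ht
  have hA : v (π * t) = ((1 + a : ℝ) : WithTop ℝ) := v.map_mul_of_eq_coe hπ ha
  have hB := v.map_pow_of_eq_coe_s12 ha q
  have key : 1 + a ≠ q * a → 1 / ((q : ℝ) - 1) = min (1 + a) (q * a) := by
    intro hne
    have hne' : v (π * t) ≠ v (t ^ q) := by
      rw [hA, hB, Ne, WithTop.coe_inj]
      exact hne
    have hs : v (π * t - t ^ q) = min (v (π * t)) (v (t ^ q)) := by
      rw [sub_eq_add_neg, v.map_add_of_distinct_val, v.map_neg]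
      rwa [v.map_neg]
    rw [h, hπ₁, hA, hB, ← WithTop.coe_min, WithTop.coe_inj] at hs
    exact hs
  have hle : min (1 + a) (q * a) ≤ 1 / ((q : ℝ) - 1) := by
    have hs := v.map_sub (π * t) (t ^ q)
    rw [h, hπ₁, hA, hB, ← WithTop.coe_min, WithTop.coe_le_coe] at hs
    exact hs
  have hr : 1 / ((q : ℝ) - 1) * ((q : ℝ) - 1) = 1 := by field_simp
  set r := 1 / ((q : ℝ) - 1) with hrdef
  have hr0 : 0 < r := by positivity
  have hlt : q * a < 1 + a := by
    by_contra! hge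
    rw [min_eq_left hge] at hle
    nlinarith
  have := key hlt.ne'
  rw [min_eq_right hlt.le] at this
  rw [ha, WithTop.coe_inj, ← div_div, div_right_comm, ← hrdef, this]
  field_simp

end AddValuation

/-- The identity satisfied by the level-two Moore determinant once `X₁` and `Y₁` are expanded. -/
theorem moore_two_expand {K : Type*} [CommRing K] (p f q : ℕ) [Fact p.Prime] [CharP K p]
    (hq : q = p ^ f) {π u X₂ Y₂ X₁ Y₁ : K}
    (hX₁ : X₁ = X₂ ^ q ^ 2 + u * X₂ ^ q + π * X₂)
    (hY₁ : Y₁ = Y₂ ^ q ^ 2 + u * Y₂ ^ q + π * Y₂) :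
    X₁ * Y₂ ^ q - X₁ ^ q * Y₂ - X₂ ^ q * Y₁ + X₂ * Y₁ ^ q =
      X₂ ^ q ^ 2 * Y₂ ^ q - X₂ ^ q * Y₂ ^ q ^ 2 + X₂ * Y₂ ^ q ^ 3 +
      (π * X₂ * Y₂ ^ q - X₁ ^ q * Y₂ - π * X₂ ^ q * Y₂ + u ^ q * X₂ * Y₂ ^ q ^ 2 +
        π ^ q * X₂ * Y₂ ^ q) := by
  have hY : Y₁ ^ q = Y₂ ^ q ^ 3 + u ^ q * Y₂ ^ q ^ 2 + π ^ q * Y₂ ^ q := by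
    rw [hY₁, hq, add_pow_char_pow, add_pow_char_pow, ← hq, mul_pow, mul_pow, ← pow_mul, ← pow_mul,
      ← pow_succ, ← sq]
  rw [hY]
  generalize X₁ ^ q = W
  rw [hX₁, hY₁]
  ring

/-- The first and second steps of the reduction: `Z ^ q` and `Z₁ ^ q` in terms of `x`, `y`. -/
theorem pow_sub_eq_of_moore {K : Type*} [Field K] (p f q : ℕ) [Fact p.Prime] [CharP K p]
    (hq : q = p ^ f) (hq2 : 2 ≤ q) {x y Z Z₁ γ₁ γ₂ α E : K}
    (hα0 : α ≠ 0) (hγ0 : γ₂ ≠ 0) (hy0 : y ≠ 0)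
    (hγ₂ : γ₂ ^ q ^ 2 = α ^ (q * (q - 1) ^ 2)) (hγ₁ : γ₁ = γ₂ ^ q)
    (hZ : Z = (1 + x * y ^ q) / γ₁)
    (hZ₁ : Z₁ = (Z + y ^ (q ^ 2 - 1) + (y ^ (q ^ 2 - 1))⁻¹) / (γ₂ * y ^ (q ^ 2 - 1)))
    (hE : (α ^ q * x) ^ q ^ 2 * (α * y) ^ q - (α ^ q * x) ^ q * (α * y) ^ q ^ 2 +
      (α ^ q * x) * (α * y) ^ q ^ 3 + E = α ^ (2 * q ^ 2)) :
    Z ^ q = x ^ q ^ 2 * y ^ q + x * y ^ q ^ 3 + E / (γ₁ ^ q * α ^ (2 * q ^ 2)) ∧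
    Z₁ ^ q - Z = γ₁ * (γ₁ ^ (q ^ 2 - 2) * Z ^ q ^ 2 / (y ^ (q ^ 2 - 1)) ^ (2 * q)) +
      E / (γ₁ ^ q * α ^ (2 * q ^ 2) * γ₁) / (y ^ (q ^ 2 - 1)) ^ q := by
  have hγ10 : γ₁ ≠ 0 := hγ₁ ▸ pow_ne_zero _ hγ0
  have hγα : α ^ (q ^ 3 + q) = α ^ (2 * q ^ 2) * γ₁ ^ q := by
    have : q ^ 3 + q = 2 * q ^ 2 + q * (q - 1) ^ 2 := by
      obtain ⟨k, rfl⟩ := Nat.exists_eq_add_of_le hq2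
      rw [show 2 + k - 1 = k + 1 by omega]
      ring
    rw [hγ₁, ← pow_mul, ← sq, hγ₂, this, pow_add]
  have hxy : x * y ^ q = γ₁ * Z - 1 := by
    rw [hZ]
    field_simp
    ring
  have hZq : γ₁ ^ q * Z ^ q = 1 + x ^ q * y ^ q ^ 2 := by
    rw [← mul_pow, ← sub_add_cancel (γ₁ * Z) 1, ← hxy]
    subst hq
    rw [add_pow_char_pow, one_pow, mul_pow, ← pow_mul, ← sq, add_comm]
  have h1 : Z ^ q = x ^ q ^ 2 * y ^ q + x * y ^ q ^ 3 + E / (γ₁ ^ q * α ^ (2 * q ^ 2)) := by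
    have e1 : (α ^ q * x) ^ q ^ 2 * (α * y) ^ q = α ^ (q ^ 3 + q) * (x ^ q ^ 2 * y ^ q) := by
      ring
    have e2 : (α ^ q * x) ^ q * (α * y) ^ q ^ 2 = α ^ (2 * q ^ 2) * (x ^ q * y ^ q ^ 2) := by
      ring
    have e3 : (α ^ q * x) * (α * y) ^ q ^ 3 = α ^ (q ^ 3 + q) * (x * y ^ q ^ 3) := by
      ring
    rw [e1, e2, e3, hγα] at hE
    have hα2 : α ^ (2 * q ^ 2) ≠ 0 := pow_ne_zero _ hα0
    have hγq : γ₁ ^ q ≠ 0 := pow_ne_zero _ hγ10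
    rw [← sub_eq_iff_eq_add', eq_div_iff (mul_ne_zero hγq hα2)]
    linear_combination α ^ (2 * q ^ 2) * hZq - hE
  refine ⟨h1, ?_⟩
  have hT0 : y ^ (q ^ 2 - 1) ≠ 0 := pow_ne_zero _ hy0
  have hT : (y ^ (q ^ 2 - 1)) ^ q * y ^ q = y ^ q ^ 3 := by
    rw [← mul_pow, ← pow_succ, Nat.sub_add_cancel (Nat.one_le_pow _ _ (by omega)), ← pow_mul]
    ring
  have hxy2 : x ^ q ^ 2 * y ^ q ^ 3 = γ₁ ^ q ^ 2 * Z ^ q ^ 2 - 1 := by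
    have : (x * y ^ q) ^ q ^ 2 = (γ₁ * Z - 1) ^ q ^ 2 := by rw [hxy]
    rw [mul_pow, ← pow_mul, ← pow_succ'] at this
    rw [this, hq, ← pow_mul, sub_pow_char_pow, mul_pow, one_pow]
  have hZ1q : Z₁ ^ q * (γ₁ * (y ^ (q ^ 2 - 1)) ^ q) =
      Z ^ q + (y ^ (q ^ 2 - 1)) ^ q + ((y ^ (q ^ 2 - 1)) ^ q)⁻¹ := by
    rw [hγ₁, ← mul_pow, ← mul_pow, hZ₁, div_mul_cancel₀ _ (mul_ne_zero hγ0 hT0)]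
    generalize y ^ (q ^ 2 - 1) = T
    subst hq
    rw [add_pow_char_pow, add_pow_char_pow, inv_pow]
  have hγsq : γ₁ ^ q ^ 2 = γ₁ ^ (q ^ 2 - 2) * γ₁ * γ₁ := by
    rw [← pow_succ, ← pow_succ]
    congr 1
    have : 2 ≤ q ^ 2 := by nlinarith
    omega
  have hTT : (y ^ (q ^ 2 - 1)) ^ (2 * q) = (y ^ (q ^ 2 - 1)) ^ q * (y ^ (q ^ 2 - 1)) ^ q := by
    rw [two_mul, pow_add]
  rw [hTT, mul_comm _ γ₁, mul_comm γ₁ (γ₁ ^ q * _), ← div_div E _ γ₁]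
  rw [hγsq] at hxy2
  have hxq : x ^ q ^ 2 * y ^ q = (γ₁ ^ (q ^ 2 - 2) * γ₁ * γ₁ * Z ^ q ^ 2 - 1) /
      (y ^ (q ^ 2 - 1)) ^ q := by
    rw [eq_div_iff (pow_ne_zero _ hT0), ← hxy2, ← hT]
    ring
  have hxq3 : x * y ^ q ^ 3 = (γ₁ * Z - 1) * (y ^ (q ^ 2 - 1)) ^ q := by
    rw [← hxy, ← hT]
    ring
  rw [h1, hxq, hxq3] at hZ1q
  have hTq0 := pow_ne_zero q hT0
  generalize (y ^ (q ^ 2 - 1)) ^ q = S at *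
  generalize E / (γ₁ ^ q * α ^ (2 * q ^ 2)) = E' at *
  generalize γ₁ ^ (q ^ 2 - 2) = G at *
  have hZ1' : Z₁ ^ q = ((G * γ₁ * γ₁ * Z ^ q ^ 2 - 1) / S + (γ₁ * Z - 1) * S + E' + S + S⁻¹) /
      (γ₁ * S) := by
    rw [eq_div_iff (mul_ne_zero hγ10 hTq0), hZ1q]
  rw [hZ1']
  field_simp
  ring

/-- reduction of the space Z^{π₂}_{1,1,e₁}. With x = X₂/α^q,
y = Y₂/α (α^{2q²} = π₂), Z = (1 + x y^q)/γ₁ and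
Z₁ = (Z + y^{q²−1} + y^{−(q²−1)})/(γ₂ y^{q²−1}) (γ₂^{q²} = α^{q(q−1)²}, γ₁ = γ₂^q),
the residues satisfy Z₁^q + y^{q²−1} + 1/y^{q²−1} = 0. -/
theorem stmt_12 (p f q : ℕ) (hp : p.Prime) (hf : 0 < f) (hq : q = p ^ f)
    (K : Type*) [Field K] [IsAlgClosed K] [CharP K p]
    (v : K → WithTop ℝ)
    (hv_top : ∀ x : K, v x = ⊤ ↔ x = 0)
    (hv_mul : ∀ x y : K, v (x * y) = v x + v y)
    (hv_add : ∀ x y : K, min (v x) (v y) ≤ v (x + y))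
    (π : K) (hπ : v π = 1)
    (π₁ : K) (hπ₁ : π₁ ^ (q - 1) = π)
    (π₂ : K) (hπ₂ : π * π₂ - π₂ ^ q = π₁)
    (u X₂ Y₂ X₁ Y₁ : K)
    (hX₁ : X₁ = X₂ ^ q ^ 2 + u * X₂ ^ q + π * X₂)
    (hY₁ : Y₁ = Y₂ ^ q ^ 2 + u * Y₂ ^ q + π * Y₂)
    (htorX : X₁ ^ q ^ 2 + u * X₁ ^ q + π * X₁ = 0)
    (htorY : Y₁ ^ q ^ 2 + u * Y₁ ^ q + π * Y₁ = 0)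
    (hμ₂ : X₁ * Y₂ ^ q - X₁ ^ q * Y₂ - X₂ ^ q * Y₁ + X₂ * Y₁ ^ q = π₂)
    (hu : v u = ((1 / 2 : ℝ) : WithTop ℝ))
    (hvX₁ : v X₁ = ((1 / (2 * ((q : ℝ) - 1)) : ℝ) : WithTop ℝ))
    (hvX₂ : v X₂ = ((1 / (2 * (q : ℝ) ^ 2 * ((q : ℝ) - 1)) : ℝ) : WithTop ℝ))
    (hvY₁ : v Y₁ = ((1 / (2 * (q : ℝ) * ((q : ℝ) - 1)) : ℝ) : WithTop ℝ))
    (hvY₂ : v Y₂ = ((1 / (2 * (q : ℝ) ^ 3 * ((q : ℝ) - 1)) : ℝ) : WithTop ℝ))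
    (α : K) (hα : α ^ (2 * q ^ 2) = π₂)
    (γ₂ : K) (hγ₂ : γ₂ ^ q ^ 2 = α ^ (q * (q - 1) ^ 2))
    (γ₁ : K) (hγ₁ : γ₁ = γ₂ ^ q)
    (x y Z Z₁ : K) (hx : x = X₂ / α ^ q) (hy : y = Y₂ / α)
    (hZ : Z = (1 + x * y ^ q) / γ₁)
    (hZ₁ : Z₁ = (Z + y ^ (q ^ 2 - 1) + (y ^ (q ^ 2 - 1))⁻¹) / (γ₂ * y ^ (q ^ 2 - 1))) :
    v x = 0 ∧ v y = 0 ∧ 0 ≤ v Z ∧ 0 ≤ v Z₁ ∧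
    0 < v (Z₁ ^ q + y ^ (q ^ 2 - 1) + (y ^ (q ^ 2 - 1))⁻¹) := by
  have : Fact p.Prime := ⟨hp⟩
  have hq2 : 2 ≤ q := by
    rw [hq]
    exact hp.two_le.trans (Nat.le_self_pow hf.ne' p)
  have hv1 : v 1 = 0 := by
    have h := hv_mul 1 1
    have h1 : v 1 ≠ ⊤ := by simp [hv_top]
    obtain ⟨a, ha⟩ := WithTop.ne_top_iff_exists.mp h1
    rw [mul_one, ← ha, ← WithTop.coe_add, WithTop.coe_inj] at h
    rw [← ha, WithTop.coe_eq_zero]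
    linarith
  obtain ⟨w, rfl⟩ : ∃ w : AddValuation K (WithTop ℝ), (w : K → WithTop ℝ) = v :=
    ⟨AddValuation.of v ((hv_top 0).mpr rfl) hv1 hv_add hv_mul, rfl⟩
  have hqR : (2 : ℝ) ≤ q := by exact_mod_cast hq2
  have hq1 : (0 : ℝ) < (q : ℝ) - 1 := by linarith
  have hq0 : q ≠ 0 := by omega
  have hcast : ((q - 1 : ℕ) : ℝ) = (q : ℝ) - 1 := by
    rw [Nat.cast_sub (by omega), Nat.cast_one]
  have hvπ₁ : w π₁ = ((1 / ((q : ℝ) - 1) : ℝ) : WithTop ℝ) := by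
    rw [← hcast]
    exact w.eq_coe_of_map_pow_s12 (by omega) (by rw [hπ₁, hπ]; rfl)
  have hvπ₂ := w.eq_coe_of_mul_sub_pow hq2 hπ hvπ₁ hπ₂
  obtain ⟨c, hc⟩ : ∃ c : ℝ, c = 1 / (2 * (q : ℝ) ^ 3 * ((q : ℝ) - 1)) := ⟨_, rfl⟩
  have hc0 : 0 < c := by rw [hc]; positivity
  have hπ' : w π = ((2 * q ^ 3 * (q - 1) * c : ℝ) : WithTop ℝ) := by
    rw [hπ, ← WithTop.coe_one, WithTop.coe_inj, hc]
    field_simp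
  have hu' : w u = ((q ^ 3 * (q - 1) * c : ℝ) : WithTop ℝ) := by
    rw [hu, WithTop.coe_inj, hc]
    field_simp
  have hX₁' : w X₁ = ((q ^ 3 * c : ℝ) : WithTop ℝ) := by
    rw [hvX₁, WithTop.coe_inj, hc]
    field_simp
  have hX₂' : w X₂ = ((q * c : ℝ) : WithTop ℝ) := by
    rw [hvX₂, WithTop.coe_inj, hc]
    field_simp
  have hY₂' : w Y₂ = (c : WithTop ℝ) := by rw [hvY₂, hc]
  have hα' : w α = (c : WithTop ℝ) := by
    rw [w.eq_coe_of_map_pow_s12 (n := 2 * q ^ 2) (by positivity) (hα ▸ hvπ₂), WithTop.coe_inj, hc]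
    push_cast
    field_simp
  have hγ₂' : w γ₂ = (((q - 1) ^ 2 / q * c : ℝ) : WithTop ℝ) := by
    rw [w.eq_coe_of_map_pow_s12 (n := q ^ 2) (by positivity)
      (hγ₂ ▸ w.map_pow_of_eq_coe_s12 hα' _), WithTop.coe_inj]
    push_cast [hcast]
    field_simp
  have hγ₁' : w γ₁ = (((q - 1) ^ 2 * c : ℝ) : WithTop ℝ) := by
    rw [hγ₁, w.map_pow_of_eq_coe_s12 hγ₂', WithTop.coe_inj]
    field_simp
  have hvx : w x = 0 := by
    rw [hx, w.map_div_of_eq_coe hX₂' (w.map_pow_of_eq_coe_s12 hα' q), sub_self, WithTop.coe_zero]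
  have hvy : w y = 0 := by
    rw [hy, w.map_div_of_eq_coe hY₂' hα', sub_self, WithTop.coe_zero]
  have hα0 := w.ne_zero_of_eq_coe hα'
  have hγ0 := w.ne_zero_of_eq_coe hγ₂'
  have hy0 : y ≠ 0 := w.ne_zero_of_eq_coe (a := 0) hvy
  have hXx : α ^ q * x = X₂ := by
    rw [hx, mul_div_cancel₀ _ (pow_ne_zero _ hα0)]
  have hYy : α * y = Y₂ := by
    rw [hy, mul_div_cancel₀ _ hα0]
  have hμ := moore_two_expand p f q hq hX₁ hY₁
  rw [hμ₂] at hμ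
  obtain ⟨E, hE⟩ : ∃ E, E = π * X₂ * Y₂ ^ q - X₁ ^ q * Y₂ - π * X₂ ^ q * Y₂ +
    u ^ q * X₂ * Y₂ ^ q ^ 2 + π ^ q * X₂ * Y₂ ^ q := ⟨_, rfl⟩
  have hvE : (((q ^ 3 + q ^ 2 - q + 1) * c : ℝ) : WithTop ℝ) < w E := by
    obtain ⟨t, ht0, ht⟩ : ∃ t : ℝ, 0 ≤ t ∧ (q : ℝ) = t + 2 := ⟨q - 2, by linarith, by ring⟩
    rw [hE]
    refine w.map_lt_add (w.map_lt_add (w.lt_map_sub (w.lt_map_sub ?_ ?_) ?_) ?_) ?_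
    · rw [w.map_mul_of_eq_coe (w.map_mul_of_eq_coe hπ' hX₂') (w.map_pow_of_eq_coe_s12 hY₂' q),
        WithTop.coe_lt_coe, ht, ← sub_pos]
      ring_nf
      positivity
    · rw [w.map_mul_of_eq_coe (w.map_pow_of_eq_coe_s12 hX₁' q) hY₂',
        WithTop.coe_lt_coe, ht, ← sub_pos]
      ring_nf
      positivity
    · rw [w.map_mul_of_eq_coe (w.map_mul_of_eq_coe hπ' (w.map_pow_of_eq_coe_s12 hX₂' q)) hY₂',
        WithTop.coe_lt_coe, ht, ← sub_pos]
      ring_nf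
      positivity
    · rw [w.map_mul_of_eq_coe (w.map_mul_of_eq_coe (w.map_pow_of_eq_coe_s12 hu' q) hX₂')
        (w.map_pow_of_eq_coe_s12 hY₂' (q ^ 2)), WithTop.coe_lt_coe, Nat.cast_pow, ht, ← sub_pos]
      ring_nf
      positivity
    · rw [w.map_mul_of_eq_coe (w.map_mul_of_eq_coe (w.map_pow_of_eq_coe_s12 hπ' q) hX₂')
        (w.map_pow_of_eq_coe_s12 hY₂' q), WithTop.coe_lt_coe, ht, ← sub_pos]
      ring_nf
      positivity
  rw [← hE, ← hXx, ← hYy, ← hα] at hμ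
  obtain ⟨hZq, hZ₁q⟩ := pow_sub_eq_of_moore p f q hq hq2 hα0 hγ0 hy0 hγ₂ hγ₁ hZ hZ₁ hμ.symm
  have hγα : w (γ₁ ^ q * α ^ (2 * q ^ 2) * γ₁) =
      (((q ^ 3 + q ^ 2 - q + 1) * c : ℝ) : WithTop ℝ) := by
    rw [w.map_mul_of_eq_coe (w.map_mul_of_eq_coe (w.map_pow_of_eq_coe_s12 hγ₁' q)
      (w.map_pow_of_eq_coe_s12 hα' _)) hγ₁', WithTop.coe_inj]
    push_cast
    ring
  have hE₂ := w.pos_div hvE hγα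
  have hγ₁pos : 0 < w γ₁ := by
    rw [hγ₁', WithTop.coe_pos]
    positivity
  have hγ₂pos : 0 < w γ₂ := by
    rw [hγ₂', WithTop.coe_pos]
    positivity
  have hE₁ : 0 < w (E / (γ₁ ^ q * α ^ (2 * q ^ 2))) := by
    have := w.pos_mul hE₂ hγ₁pos.le
    rwa [← div_div, div_mul_cancel₀ _ (w.ne_zero_of_eq_coe hγ₁')] at this
  have hvZ : 0 ≤ w Z := by
    apply w.nonneg_of_map_pow hq0
    rw [hZq]
    refine w.nonneg_add (w.nonneg_add ?_ ?_) hE₁.le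
    · exact w.nonneg_mul (w.nonneg_pow hvx.ge _) (w.nonneg_pow hvy.ge _)
    · exact w.nonneg_mul hvx.ge (w.nonneg_pow hvy.ge _)
  have hvT : ∀ n m : ℕ, w ((y ^ n) ^ m)⁻¹ = 0 := by
    intro n m
    rw [← one_div, w.map_div_of_eq_coe (a := 0) (b := 0) hv1, sub_zero, WithTop.coe_zero]
    rw [w.map_pow, w.map_pow, hvy, nsmul_zero, nsmul_zero, WithTop.coe_zero]
  have hdiff : 0 < w (Z₁ ^ q - Z) := by
    rw [hZ₁q]
    refine w.map_lt_add ?_ ?_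
    · refine w.pos_mul hγ₁pos ?_
      rw [div_eq_mul_inv]
      exact w.nonneg_mul (w.nonneg_mul (w.nonneg_pow hγ₁pos.le _) (w.nonneg_pow hvZ _))
        (hvT _ _).ge
    · rw [div_eq_mul_inv]
      exact w.pos_mul hE₂ (hvT _ _).ge
  have hvZ₁ : 0 ≤ w Z₁ := by
    apply w.nonneg_of_map_pow hq0
    rw [← sub_add_cancel (Z₁ ^ q) Z]
    exact w.nonneg_add hdiff.le hvZ
  refine ⟨hvx, hvy, hvZ, hvZ₁, ?_⟩
  have hfin : Z₁ ^ q + y ^ (q ^ 2 - 1) + (y ^ (q ^ 2 - 1))⁻¹ =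
      (Z₁ ^ q - Z) + γ₂ * (y ^ (q ^ 2 - 1) * Z₁) := by
    have : γ₂ * (y ^ (q ^ 2 - 1) * Z₁) = Z + y ^ (q ^ 2 - 1) + (y ^ (q ^ 2 - 1))⁻¹ := by
      rw [← mul_assoc, hZ₁, mul_div_cancel₀ _ (mul_ne_zero hγ0 (pow_ne_zero _ hy0))]
    rw [this]
    ring
  rw [hfin]
  exact w.map_lt_add hdiff (w.pos_mul hγ₂pos (w.nonneg_mul (w.nonneg_pow hvy.ge _) hvZ₁))
end

section
/- (Singular locus of the reduction of Z^{π₂}_{1,1,e₁}.) Let k be an algebraically closed field of odd characteristic p and q = p^f. Let f = Z^q y^{q²−1} + y^{2(q²−1)} + 1 ∈ k[y, Z], whose zero locus in {y ≠ 0} is the curve Z^q + y^{q²−1} + y^{−(q²−1)} = 0. Then the set of points (y, Z) ∈ k^× × k with f(y,Z) = 0 at which both formal partial derivatives ∂f/∂y and ∂f/∂Z vanish is exactly {(y, Z) : y^{2(q²−1)} = 1 and Z^q = −2y^{q²−1}}, and this set has cardinality 2(q²−1). -/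
open MvPolynomial

/-- In an algebraically closed field, there are exactly `m` solutions of `y ^ m = 1` when `m` is
invertible. -/
theorem ncard_pow_eq_one {k : Type*} [Field k] [IsAlgClosed k] (m : ℕ) (hm : (m : k) ≠ 0) :
    {y : k | y ^ m = 1}.ncard = m := by
  have : NeZero (m : k) := ⟨hm⟩
  have hm0 : 0 < m := Nat.pos_of_ne_zero (by rintro rfl; simp at hm)
  obtain ⟨ζ, hζ⟩ := HasEnoughRootsOfUnity.exists_primitiveRoot k m
  refine Eq.trans ?_ hζ.card_nthRootsFinset
  rw [← Set.ncard_coe_finset]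
  congr 1
  ext y
  simp [Polynomial.mem_nthRootsFinset hm0]

/-- When `Z ↦ Z ^ q` is bijective, a set cut out by a condition on the first coordinate and an
equation determining the `q`-th power of the second has as many points as its first projection. -/
theorem ncard_pairs_eq_of_bijective_pow {k : Type*} [Field k] (q : ℕ)
    (hq : Function.Bijective fun z : k => z ^ q) (A : Set k) (g : k → k) :
    {P : Fin 2 → k | P 0 ∈ A ∧ P 1 ^ q = g (P 0)}.ncard = A.ncard := by
  refine Set.ncard_congr (fun P _ => P 0) (fun P hP => hP.1) ?_ ?_
  · rintro P Q ⟨-, hP⟩ ⟨-, hQ⟩ h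
    have h0 : P 0 = Q 0 := h
    have h1 : P 1 = Q 1 := hq.1 (show P 1 ^ q = Q 1 ^ q by rw [hP, hQ, h0])
    ext i
    fin_cases i
    exacts [h0, h1]
  · intro y hy
    obtain ⟨z, hz⟩ := hq.2 (g y)
    exact ⟨![y, z], ⟨hy, hz⟩, rfl⟩

/-- singular locus of the reduction of Z^{π₂}_{1,1,e₁}, the plane curve
f = Z^q y^{q²−1} + y^{2(q²−1)} + 1 = 0 in {y ≠ 0} (coordinates P 0 = y, P 1 = Z).
The points with y ≠ 0, f = 0 where both partials vanish are exactly the 2(q²−1)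
points with y^{2(q²−1)} = 1 and Z^q = −2 y^{q²−1}. -/
theorem stmt_13 (p f q : ℕ) (hp : p.Prime) (hodd : p ≠ 2) (hf : 0 < f) (hq : q = p ^ f)
    (k : Type*) [Field k] [IsAlgClosed k] [CharP k p]
    (F : MvPolynomial (Fin 2) k)
    (hF : F = X 1 ^ q * X 0 ^ (q ^ 2 - 1) + X 0 ^ (2 * (q ^ 2 - 1)) + 1)
    (S : Set (Fin 2 → k))
    (hS : S = {P | P 0 ≠ 0 ∧ eval P F = 0 ∧
      eval P (pderiv 0 F) = 0 ∧ eval P (pderiv 1 F) = 0}) :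
    S = {P | (P 0) ^ (2 * (q ^ 2 - 1)) = 1 ∧ (P 1) ^ q = -2 * (P 0) ^ (q ^ 2 - 1)} ∧
    S.ncard = 2 * (q ^ 2 - 1) := by
  have : Fact p.Prime := ⟨hp⟩
  have hqk : (q : k) = 0 := by rw [hq]; simp [hf.ne']
  have hq1 : 1 < q := hq ▸ Nat.one_lt_pow hf.ne' hp.one_lt
  have h2 : (2 : k) ≠ 0 := Ring.two_ne_zero (by rwa [ringChar.eq k p])
  have hbij : Function.Bijective fun z : k => z ^ q := by
    refine ⟨fun a b h => iterateFrobenius_inj k p f ?_, fun a =>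
      IsAlgClosed.exists_pow_nat_eq a (by omega)⟩
    simpa [iterateFrobenius_def, hq] using h
  obtain ⟨m, hm⟩ : ∃ m, q ^ 2 - 1 = m + 1 :=
    ⟨q ^ 2 - 2, by have := Nat.pow_lt_pow_left hq1 two_ne_zero; omega⟩
  have hmk : ((m : k) + 1) = -1 := by
    have h : m + 1 + 1 = q ^ 2 := by omega
    have h' := congrArg (Nat.cast : ℕ → k) h
    push_cast at h'
    rw [hqk] at h'
    linear_combination h'
  rw [hm] at hF ⊢
  have hmain : S = {P | (P 0) ^ (2 * (m + 1)) = 1 ∧ (P 1) ^ q = -2 * (P 0) ^ (m + 1)} := by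
    have e0 (P : Fin 2 → k) : eval P F = P 1 ^ q * P 0 ^ (m + 1) + P 0 ^ (2 * (m + 1)) + 1 := by
      simp [hF]
    have e1 (P : Fin 2 → k) : eval P (pderiv 0 F) =
        -(P 0 ^ m * (P 1 ^ q + 2 * P 0 ^ (m + 1))) := by
      have : 2 * (m + 1) - 1 = 2 * m + 1 := by omega
      simp [hF, pderiv_X, Derivation.leibniz, Derivation.leibniz_pow, hmk, this]
      ring
    have e2 (P : Fin 2 → k) : eval P (pderiv 1 F) = 0 := by
      simp [hF, pderiv_X, Derivation.leibniz, Derivation.leibniz_pow, hqk]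
    subst hS
    ext P
    simp only [Set.mem_ofPred_eq, e0, e1, e2, and_true]
    constructor
    · rintro ⟨h0, h1, h3⟩
      have h4 := (mul_eq_zero.1 (neg_eq_zero.1 h3)).resolve_left (pow_ne_zero _ h0)
      exact ⟨by linear_combination -h1 + P 0 ^ (m + 1) * h4, by linear_combination h4⟩
    · rintro ⟨h1, h3⟩
      refine ⟨?_, by linear_combination -h1 + P 0 ^ (m + 1) * h3,
        by linear_combination -P 0 ^ m * h3⟩
      intro h0
      simp [h0] at h1
  refine ⟨hmain, ?_⟩
  rw [hmain]
  refine (ncard_pairs_eq_of_bijective_pow q hbij {y | y ^ (2 * (m + 1)) = 1}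
    fun y => -2 * y ^ (m + 1)).trans (ncard_pow_eq_one _ ?_)
  push_cast
  rw [hmk]
  simpa using h2
end

section
/- (Core of the claim that the reduction of Z^{π₂}_{1,1,c} has q−1 connected components.) Suppose u, X₂, Y₂ ∈ K satisfy: v(u) = 1/2, [π]_u([π]_u(X₂)) = [π]_u([π]_u(Y₂)) = 0, μ₂(X₂,Y₂) = π₂, and the valuation conditions v(X₁) = v(Y₁) = 1/(2q(q−1)) and v(X₂) = v(Y₂) = 1/(2q³(q−1)), where X₁ = [π]_u(X₂) and Y₁ = [π]_u(Y₂). Then a = X₂/Y₂ satisfies v(a) = 0 and v(a^q − a) = 1/(2q³); in particular the residue of a lies in F_q^×. -/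
/-- Valuation of a power, for an additive valuation with real values. -/
theorem AddValuation.map_pow_coe {K : Type*} [Field K] (w : AddValuation K (WithTop ℝ)) {x : K}
    {r : ℝ} (hx : w x = (r : WithTop ℝ)) (n : ℕ) :
    w (x ^ n) = (((n : ℝ) * r : ℝ) : WithTop ℝ) := by
  rw [w.map_pow, hx, ← WithTop.coe_nsmul, nsmul_eq_mul]

/-- Valuation of a product, for an additive valuation with real values. -/
theorem AddValuation.map_mul_coe {K : Type*} [Field K] (w : AddValuation K (WithTop ℝ)) {x y : K}
    {r s : ℝ} (hx : w x = (r : WithTop ℝ)) (hy : w y = (s : WithTop ℝ)) :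
    w (x * y) = ((r + s : ℝ) : WithTop ℝ) := by
  rw [w.map_mul, hx, hy, WithTop.coe_add]

/-- A nonzero element has a real valuation. -/
theorem AddValuation.exists_coe {K : Type*} [Field K] (w : AddValuation K (WithTop ℝ)) {x : K}
    (hx : x ≠ 0) : ∃ r : ℝ, w x = (r : WithTop ℝ) := by
  obtain ⟨r, hr⟩ := WithTop.ne_top_iff_exists.1 (mt w.top_iff.1 hx)
  exact ⟨r, hr.symm⟩

/-- The valuation of a solution of `π z - z ^ q = π₁`, read off from the Newton polygon. -/
theorem AddValuation.eq_of_mul_sub_pow {K : Type*} [Field K] (w : AddValuation K (WithTop ℝ))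
    {q : ℕ} (hq : 2 ≤ q) {π π₁ z : K} (hπ : w π = ((1 : ℝ) : WithTop ℝ))
    (hπ₁ : π₁ ^ (q - 1) = π) (hz : π * z - z ^ q = π₁) :
    w z = ((1 / ((q : ℝ) * ((q : ℝ) - 1)) : ℝ) : WithTop ℝ) := by
  have hQ : (2 : ℝ) ≤ q := by exact_mod_cast hq
  have hπ0 : π ≠ 0 := by
    rintro rfl
    simp at hπ
  have hπ₁0 : π₁ ≠ 0 := by
    rintro rfl
    exact hπ0 (by rw [← hπ₁, zero_pow (by omega)])
  have hz0 : z ≠ 0 := by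
    rintro rfl
    exact hπ₁0 (by rw [← hz, zero_pow (by omega)]; simp)
  obtain ⟨s, hs⟩ := w.exists_coe hπ₁0
  obtain ⟨r, hr⟩ := w.exists_coe hz0
  have hs1 : ((q : ℝ) - 1) * s = 1 := by
    have h := w.map_pow_coe hs (q - 1)
    rw [hπ₁, hπ, Nat.cast_sub (by omega)] at h
    exact_mod_cast h.symm
  have hA := w.map_mul_coe hπ hr
  have hB := w.map_pow_coe hr q
  have hle := w.map_sub (π * z) (z ^ q)
  rw [hz, hA, hB, hs, ← WithTop.coe_min, WithTop.coe_le_coe] at hle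
  rw [hr, WithTop.coe_inj, eq_div_iff (by nlinarith)]
  rcases lt_trichotomy (1 + r) (q * r) with h | h | h
  · have h1 : w π₁ = ((1 + r : ℝ) : WithTop ℝ) := by
      rw [← hz, w.map_sub_eq_of_lt_left (by rw [hA, hB]; exact_mod_cast h), hA]
    rw [hs, WithTop.coe_inj] at h1
    nlinarith
  · rw [← h, min_self] at hle
    nlinarith
  · have h1 : w π₁ = ((q * r : ℝ) : WithTop ℝ) := by
      rw [← hz, w.map_sub_eq_of_lt_right (by rw [hA, hB]; exact_mod_cast h), hB]
    rw [hs, WithTop.coe_inj] at h1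
    rw [h1] at hs1
    linarith

/-- If a product of differences `a - ζ` has positive valuation, so does one of its factors. -/
theorem AddValuation.exists_pos_of_multiset_prod {K : Type*} [Field K]
    (w : AddValuation K (WithTop ℝ)) (s : Multiset K) (h : 0 < w s.prod) :
    ∃ x ∈ s, 0 < w x := by
  induction s using Multiset.induction_on with
  | empty => simp at h
  | cons x s ih =>
    by_cases hx : 0 < w x
    · exact ⟨x, by simp, hx⟩
    · rw [Multiset.prod_cons, w.map_mul] at h
      have hs : 0 < w s.prod := by
        by_contra hs
        exact absurd h (not_lt.2 (add_nonpos (not_lt.1 hx) (not_lt.1 hs)))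
      obtain ⟨z, hz, hz'⟩ := ih hs
      exact ⟨z, Multiset.mem_cons_of_mem hz, hz'⟩

open Polynomial in
/-- An element with `v (a ^ q - a) > 0` is congruent to a root of `X ^ q - X`. -/
theorem AddValuation.exists_pow_eq_self_of_pos {K : Type*} [Field K] [IsAlgClosed K]
    (w : AddValuation K (WithTop ℝ)) {q : ℕ} (hq : 1 < q) {a : K} (h : 0 < w (a ^ q - a)) :
    ∃ ζ : K, ζ ^ q = ζ ∧ 0 < w (a - ζ) := by
  have hm : (X ^ q - X : K[X]).Monic := monic_X_pow_sub (by rw [degree_X]; exact_mod_cast hq)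
  have hprod := (IsAlgClosed.splits (X ^ q - X : K[X])).eq_prod_roots_of_monic hm
  have hev := congrArg (Polynomial.eval a) hprod
  rw [eval_multiset_prod, Multiset.map_map] at hev
  simp only [eval_sub, eval_pow, eval_X, Function.comp_def, eval_C] at hev
  rw [hev] at h
  obtain ⟨x, hx, hpos⟩ := w.exists_pos_of_multiset_prod _ h
  obtain ⟨ζ, hζ, rfl⟩ := Multiset.mem_map.1 hx
  refine ⟨ζ, ?_, hpos⟩
  have := (mem_roots'.1 hζ).2
  simpa [sub_eq_zero] using this

/-- The level-2 Moore determinant in terms of `a = X / Y` and `d = a ^ q - a`, where `X = a Y`. -/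
theorem moore_two_eq {K : Type*} [Field K] {p f q : ℕ} [CharP K p] [Fact p.Prime] (hq : q = p ^ f)
    (π u a d Y X₁ Y₁ : K) (hd : a ^ q = a + d)
    (hX₁ : X₁ = (a * Y) ^ q ^ 2 + u * (a * Y) ^ q + π * (a * Y))
    (hY₁ : Y₁ = Y ^ q ^ 2 + u * Y ^ q + π * Y) :
    X₁ * Y ^ q - X₁ ^ q * Y - (a * Y) ^ q * Y₁ + (a * Y) * Y₁ ^ q =
      (Y ^ q) ^ q * Y ^ q * d ^ q -
        (((Y ^ q) ^ q) ^ q * Y * d + ((Y ^ q) ^ q) ^ q * Y * d ^ q +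
          ((Y ^ q) ^ q) ^ q * Y * (d ^ q) ^ q + u ^ q * (Y ^ q) ^ q * Y * d +
          u ^ q * (Y ^ q) ^ q * Y * d ^ q + π * Y ^ q * Y * d + π ^ q * Y ^ q * Y * d) := by
  have hadd : ∀ x y : K, (x + y) ^ q = x ^ q + y ^ q := fun x y => by
    rw [hq, add_pow_char_pow]
  rw [hX₁, hY₁]
  simp only [sq q, pow_mul _ q q, mul_pow, hadd, hd]
  ring


/-- on the space Z^{π₂}_{1,1,c}, the function a = X₂/Y₂ satisfies
v(a) = 0 and v(a^q − a) = 1/(2q³) > 0; in particular the residue of a lies in F_q^×,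
i.e. a is congruent (mod positive valuation) to a (q−1)-st root of unity ζ. -/
theorem stmt_15 (p f q : ℕ) (hp : p.Prime) (hf : 0 < f) (hq : q = p ^ f)
    (K : Type*) [Field K] [IsAlgClosed K] [CharP K p]
    (v : K → WithTop ℝ)
    (hv_top : ∀ x : K, v x = ⊤ ↔ x = 0)
    (hv_mul : ∀ x y : K, v (x * y) = v x + v y)
    (hv_add : ∀ x y : K, min (v x) (v y) ≤ v (x + y))
    (π : K) (hπ : v π = 1)
    (π₁ : K) (hπ₁ : π₁ ^ (q - 1) = π)
    (π₂ : K) (hπ₂ : π * π₂ - π₂ ^ q = π₁)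
    (u X₂ Y₂ X₁ Y₁ : K)
    (hX₁ : X₁ = X₂ ^ q ^ 2 + u * X₂ ^ q + π * X₂)
    (hY₁ : Y₁ = Y₂ ^ q ^ 2 + u * Y₂ ^ q + π * Y₂)
    (htorX : X₁ ^ q ^ 2 + u * X₁ ^ q + π * X₁ = 0)
    (htorY : Y₁ ^ q ^ 2 + u * Y₁ ^ q + π * Y₁ = 0)
    (hμ₂ : X₁ * Y₂ ^ q - X₁ ^ q * Y₂ - X₂ ^ q * Y₁ + X₂ * Y₁ ^ q = π₂)
    (hu : v u = ((1 / 2 : ℝ) : WithTop ℝ))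
    (hvX₁ : v X₁ = ((1 / (2 * (q : ℝ) * ((q : ℝ) - 1)) : ℝ) : WithTop ℝ))
    (hvY₁ : v Y₁ = ((1 / (2 * (q : ℝ) * ((q : ℝ) - 1)) : ℝ) : WithTop ℝ))
    (hvX₂ : v X₂ = ((1 / (2 * (q : ℝ) ^ 3 * ((q : ℝ) - 1)) : ℝ) : WithTop ℝ))
    (hvY₂ : v Y₂ = ((1 / (2 * (q : ℝ) ^ 3 * ((q : ℝ) - 1)) : ℝ) : WithTop ℝ))
    (a : K) (ha : a = X₂ / Y₂) :
    v a = 0 ∧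
    v (a ^ q - a) = ((1 / (2 * (q : ℝ) ^ 3) : ℝ) : WithTop ℝ) ∧
    ∃ ζ : K, ζ ^ (q - 1) = 1 ∧ 0 < v (a - ζ) := by
  have : Fact p.Prime := ⟨hp⟩
  have hq2 : 2 ≤ q := hq ▸ hp.two_le.trans (Nat.le_self_pow hf.ne' p)
  have hQ : (2 : ℝ) ≤ q := by exact_mod_cast hq2
  have hv1 : v 1 = 0 := by
    obtain ⟨r, hr⟩ := WithTop.ne_top_iff_exists.1 (mt (hv_top 1).1 one_ne_zero)
    have h := hv_mul 1 1
    rw [mul_one, ← hr, ← WithTop.coe_add, WithTop.coe_inj] at h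
    rw [← hr, show r = 0 by linarith, WithTop.coe_zero]
  obtain ⟨w, hw⟩ : ∃ w : AddValuation K (WithTop ℝ), ∀ x, w x = v x :=
    ⟨AddValuation.of v ((hv_top 0).2 rfl) hv1 hv_add hv_mul, fun _ => rfl⟩
  simp only [← hw] at *
  have hπ' : w π = ((1 : ℝ) : WithTop ℝ) := by rw [hπ, WithTop.coe_one]
  have hwπ₂ := w.eq_of_mul_sub_pow hq2 hπ' hπ₁ hπ₂
  generalize hQq : (q : ℝ) = Q at *
  obtain ⟨y, hy⟩ : ∃ y : ℝ, y = 1 / (2 * Q ^ 3 * (Q - 1)) := ⟨_, rfl⟩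
  have hQ1 : Q - 1 ≠ 0 := by linarith
  have hQ0 : Q ≠ 0 := by linarith
  have hy0 : 0 < y := by
    rw [hy]
    have : 0 < Q - 1 := by linarith
    positivity
  have hc : 1 / (Q * (Q - 1)) = 2 * Q ^ 2 * y := by
    rw [hy]
    field_simp
  have hδ : 1 / (2 * Q ^ 3) = (Q - 1) * y := by
    rw [hy]
    field_simp
  have hone : 2 * Q ^ 3 * (Q - 1) * y = 1 := by
    rw [hy]
    field_simp
  rw [← hy] at hvX₂ hvY₂
  rw [hc] at hwπ₂
  have hY0 : Y₂ ≠ 0 := by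
    rintro rfl
    simp at hvY₂
  have hX : X₂ = a * Y₂ := by rw [ha, div_mul_cancel₀ _ hY0]
  have ha0 : a ≠ 0 := by
    rintro rfl
    rw [hX] at hvX₂
    simp at hvX₂
  have hwa : w a = ((0 : ℝ) : WithTop ℝ) := by
    obtain ⟨r, hr⟩ := w.exists_coe ha0
    have h := w.map_mul_coe hr hvY₂
    rw [← hX, hvX₂, WithTop.coe_inj] at h
    rw [hr, show r = 0 by linarith]
  obtain ⟨d, hd⟩ : ∃ d, d = a ^ q - a := ⟨_, rfl⟩
  have hmoore := moore_two_eq hq π u a d Y₂ X₁ Y₁ (by rw [hd]; ring) (hX ▸ hX₁) hY₁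
  rw [← hX, hμ₂] at hmoore
  have hd0 : d ≠ 0 := by
    intro h
    rw [h, zero_pow (by omega), zero_pow (by omega)] at hmoore
    have : π₂ = 0 := by
      rw [hmoore]
      ring
    rw [this, w.map_zero] at hwπ₂
    exact WithTop.top_ne_coe hwπ₂
  obtain ⟨δ, hwd⟩ := w.exists_coe hd0
  have hδ0 : 0 ≤ δ := by
    have h := w.map_sub (a ^ q) a
    rw [← hd, w.map_pow_coe hwa, hwa, hwd, mul_zero, min_self, WithTop.coe_le_coe] at h
    exact h
  have hYq := w.map_pow_coe hvY₂ q
  have hYqq := w.map_pow_coe hYq q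
  have hYqqq := w.map_pow_coe hYqq q
  have hdq := w.map_pow_coe hwd q
  have hdqq := w.map_pow_coe hdq q
  have huq := w.map_pow_coe hu q
  have hπq := w.map_pow_coe hπ' q
  rw [hQq] at hYq hYqq hYqqq hdq hdqq huq hπq
  have hmain := w.map_mul_coe (w.map_mul_coe hYqq hYq) hdq
  have hQy : 0 < Q * y := by positivity
  have hQQy : 0 < Q * (Q * y) := by positivity
  have hQδ : δ ≤ Q * δ := by nlinarith
  have hQQδ : Q * δ ≤ Q * (Q * δ) := by nlinarith
  obtain ⟨T, hT⟩ : ∃ T, T = (Y₂ ^ q) ^ q * Y₂ ^ q * d ^ q := ⟨_, rfl⟩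
  obtain ⟨R, hR⟩ : ∃ R, R = T - π₂ := ⟨_, rfl⟩
  have hRlt : ∀ B : ℝ, B < (Q ^ 3 + 1) * y + δ → B < 1 → (B : WithTop ℝ) < w R := by
    intro B hB hB1
    have hB' : B < Q * (Q * (Q * y)) + y + δ := by linarith
    rw [hR, hmoore, ← hT, sub_sub_cancel]
    refine w.map_lt_add (w.map_lt_add (w.map_lt_add (w.map_lt_add (w.map_lt_add (w.map_lt_add
      ?_ ?_) ?_) ?_) ?_) ?_) ?_
    · rw [w.map_mul_coe (w.map_mul_coe hYqqq hvY₂) hwd, WithTop.coe_lt_coe]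
      linarith
    · rw [w.map_mul_coe (w.map_mul_coe hYqqq hvY₂) hdq, WithTop.coe_lt_coe]
      linarith
    · rw [w.map_mul_coe (w.map_mul_coe hYqqq hvY₂) hdqq, WithTop.coe_lt_coe]
      linarith
    · rw [w.map_mul_coe (w.map_mul_coe (w.map_mul_coe huq hYqq) hvY₂) hwd, WithTop.coe_lt_coe]
      linarith
    · rw [w.map_mul_coe (w.map_mul_coe (w.map_mul_coe huq hYqq) hvY₂) hdq, WithTop.coe_lt_coe]
      linarith
    · rw [w.map_mul_coe (w.map_mul_coe (w.map_mul_coe hπ' hYq) hvY₂) hwd, WithTop.coe_lt_coe]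
      linarith
    · rw [w.map_mul_coe (w.map_mul_coe (w.map_mul_coe hπq hYq) hvY₂) hwd, WithTop.coe_lt_coe]
      linarith
  have hc1 : 2 * Q ^ 2 * y < 1 := by
    have h : 0 < 2 * Q ^ 2 * y := by positivity
    have h' : 2 ≤ Q * (Q - 1) := by nlinarith
    nlinarith
  have hπ₂R : π₂ = T - R := by rw [hR, sub_sub_cancel]
  rw [← hT] at hmain
  have hδeq : δ = (Q - 1) * y := by
    rcases lt_trichotomy δ ((Q - 1) * y) with h | h | h
    · have hQh : Q * δ < Q * ((Q - 1) * y) := by nlinarith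
      have hTR : w T < w R := by
        rw [hmain]
        refine hRlt _ ?_ (by nlinarith)
        have h1 : (Q - 1) * δ ≤ (Q - 1) * ((Q - 1) * y) :=
          mul_le_mul_of_nonneg_left h.le (by linarith)
        have h2 : 0 < (Q - 1) ^ 2 * Q * y := by positivity
        nlinarith
      have h1 := w.map_sub_eq_of_lt_left hTR
      rw [← hπ₂R, hwπ₂, hmain, WithTop.coe_inj] at h1
      nlinarith
    · exact h
    · have hQh : Q * ((Q - 1) * y) < Q * δ := by nlinarith
      have h1 : ((2 * Q ^ 2 * y : ℝ) : WithTop ℝ) < w T := by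
        rw [hmain, WithTop.coe_lt_coe]
        nlinarith
      have h2 : ((2 * Q ^ 2 * y : ℝ) : WithTop ℝ) < w R := by
        refine hRlt _ ?_ hc1
        have h3 : 0 ≤ (Q - 1) ^ 2 * Q * y := by positivity
        nlinarith
      have h3 := (lt_min h1 h2).trans_le (w.map_sub T R)
      rw [← hπ₂R, hwπ₂] at h3
      exact absurd h3 (lt_irrefl _)
  have hpos : 0 < w (a ^ q - a) := by
    rw [← hd, hwd, hδeq]
    have : 0 < (Q - 1) * y := mul_pos (by linarith) hy0
    exact_mod_cast this
  refine ⟨by rw [hwa, WithTop.coe_zero], by rw [← hd, hwd, hδeq, hδ], ?_⟩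
  obtain ⟨ζ, hζ, hζpos⟩ := w.exists_pow_eq_self_of_pos (by omega) hpos
  refine ⟨ζ, ?_, hζpos⟩
  have hζ0 : ζ ≠ 0 := by
    rintro rfl
    rw [sub_zero, hwa, WithTop.coe_zero] at hζpos
    exact lt_irrefl _ hζpos
  refine mul_right_cancel₀ hζ0 ?_
  rw [one_mul, ← pow_succ, Nat.sub_add_cancel (by omega), hζ]
end

section
/- (Core estimate showing the space W₁ ⊂ X(π²) is an annulus of width 1/(q³(q²−1)).) Suppose u, X₂, Y₂ ∈ K satisfy: 0 < v(u) < 1/(q+1), [π]_u([π]_u(X₂)) = [π]_u([π]_u(Y₂)) = 0, μ₂(X₂,Y₂) = π₂, and the valuation conditions v(X₁) = (1−v(u))/(q−1), v(X₂) = (1−q·v(u))/(q(q−1)), v(Y₁) = v(u)/(q(q−1)), v(Y₂) = v(u)/(q³(q−1)), where X₁ = [π]_u(X₂) and Y₁ = [π]_u(Y₂). Then v(X₂ Y₁^q − π₂) > 1/(q(q−1)); that is, X₂ Y₁^q equals π₂ up to terms of valuation strictly greater than 1/(q(q−1)). -/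
theorem WithTop.exists_coe_of_nsmul_ne_top {α : Type*} [AddCommMonoid α] {n : ℕ} (hn : n ≠ 0)
    {x : WithTop α} (h : n • x ≠ ⊤) : ∃ r : α, x = (r : WithTop α) := by
  induction x with
  | top =>
    obtain ⟨k, rfl⟩ := Nat.exists_eq_succ_of_ne_zero hn
    exact absurd (by rw [succ_nsmul, WithTop.add_top]) h
  | coe r => exact ⟨r, rfl⟩

/-- A function satisfying the multiplicativity axiom of an additive valuation, and finite at `1`,
vanishes at `1`. -/
theorem map_one_of_map_mul_add {K : Type*} [Monoid K] {v : K → WithTop ℝ}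
    (hmul : ∀ x y : K, v (x * y) = v x + v y) (h1 : v 1 ≠ ⊤) : v 1 = 0 := by
  have h := hmul 1 1
  rw [mul_one] at h
  lift v 1 to ℝ using h1 with r
  norm_cast at h ⊢
  linarith

theorem map_pow_of_map_mul_add {K : Type*} [Monoid K] {v : K → WithTop ℝ}
    (hmul : ∀ x y : K, v (x * y) = v x + v y) (h1 : v 1 = 0) (x : K) (n : ℕ) :
    v (x ^ n) = n • v x := by
  induction n with
  | zero => simp [h1]
  | succ n ih => rw [pow_succ, hmul, ih, succ_nsmul]

theorem map_neg_of_map_mul_add {K : Type*} [Ring K] {v : K → WithTop ℝ}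
    (hmul : ∀ x y : K, v (x * y) = v x + v y) (h1 : v 1 = 0) (x : K) : v (-x) = v x := by
  have h : v (-1) + v (-1) = 0 := by rw [← hmul, neg_mul_neg, one_mul, h1]
  have hneg : v (-1) = 0 := by
    have hne : v (-1) ≠ ⊤ := by
      intro ht
      simp [ht] at h
    lift v (-1) to ℝ using hne with r
    norm_cast at h ⊢
    linarith
  rw [← neg_one_mul, hmul, hneg, zero_add]

/-- on the space W₁ ⊂ X(π²), one has X₂·Y₁^q = π₂ up to terms of
valuation strictly greater than 1/(q(q−1)). The valuation conditions
v(X₁) = (1−v(u))/(q−1), v(X₂) = (1−q·v(u))/(q(q−1)), v(Y₁) = v(u)/(q(q−1)) and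
v(Y₂) = v(u)/(q³(q−1)) are encoded denominator-free using ℕ-scalar multiples. -/
theorem stmt_16 (p f q : ℕ) (hp : p.Prime) (hf : 0 < f) (hq : q = p ^ f)
    (K : Type*) [Field K] [IsAlgClosed K] [CharP K p]
    (v : K → WithTop ℝ)
    (hv_top : ∀ x : K, v x = ⊤ ↔ x = 0)
    (hv_mul : ∀ x y : K, v (x * y) = v x + v y)
    (hv_add : ∀ x y : K, min (v x) (v y) ≤ v (x + y))
    (π : K) (hπ : v π = 1)
    (π₁ : K) (hπ₁ : π₁ ^ (q - 1) = π)
    (π₂ : K) (hπ₂ : π * π₂ - π₂ ^ q = π₁)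
    (u X₂ Y₂ X₁ Y₁ : K)
    (hX₁ : X₁ = X₂ ^ q ^ 2 + u * X₂ ^ q + π * X₂)
    (hY₁ : Y₁ = Y₂ ^ q ^ 2 + u * Y₂ ^ q + π * Y₂)
    (htorX : X₁ ^ q ^ 2 + u * X₁ ^ q + π * X₁ = 0)
    (htorY : Y₁ ^ q ^ 2 + u * Y₁ ^ q + π * Y₁ = 0)
    (hμ₂ : X₁ * Y₂ ^ q - X₁ ^ q * Y₂ - X₂ ^ q * Y₁ + X₂ * Y₁ ^ q = π₂)
    (hu : 0 < v u) (hu' : v u < ((1 / ((q : ℝ) + 1) : ℝ) : WithTop ℝ))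
    (hvX₁ : (q - 1) • v X₁ + v u = 1)
    (hvX₂ : (q * (q - 1)) • v X₂ + q • v u = 1)
    (hvY₁ : (q * (q - 1)) • v Y₁ = v u)
    (hvY₂ : (q ^ 3 * (q - 1)) • v Y₂ = v u) :
    ((1 / ((q : ℝ) * ((q : ℝ) - 1)) : ℝ) : WithTop ℝ) < v (X₂ * Y₁ ^ q - π₂) := by
  have hq2 : 2 ≤ q := by
    rw [hq]
    exact hp.two_le.trans (Nat.le_self_pow hf.ne' p)
  have h1 : v 1 = 0 :=
    map_one_of_map_mul_add hv_mul fun h => one_ne_zero ((hv_top 1).1 h)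
  have hpow := map_pow_of_map_mul_add hv_mul h1
  have hneg := map_neg_of_map_mul_add hv_mul h1
  have key : X₂ * Y₁ ^ q - π₂ = (X₁ ^ q * Y₂ + X₂ ^ q * Y₁) + -(X₁ * Y₂ ^ q) := by
    rw [← hμ₂]; ring
  have hq1 : q - 1 ≠ 0 := by omega
  have hq0 : q ≠ 0 := by omega
  have huT : v u ≠ ⊤ := hu'.ne_top
  have hx1 := WithTop.exists_coe_of_nsmul_ne_top hq1 (x := v X₁) fun h => by
    simp [h] at hvX₁
  have hx2 := WithTop.exists_coe_of_nsmul_ne_top (mul_ne_zero hq0 hq1) (x := v X₂) fun h => by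
    simp [h] at hvX₂
  have hy1 := WithTop.exists_coe_of_nsmul_ne_top (mul_ne_zero hq0 hq1) (x := v Y₁)
    (hvY₁ ▸ huT)
  have hy2 := WithTop.exists_coe_of_nsmul_ne_top
    (mul_ne_zero (pow_ne_zero 3 hq0) hq1) (x := v Y₂) (hvY₂ ▸ huT)
  obtain ⟨a, ha⟩ := WithTop.ne_top_iff_exists.1 huT
  obtain ⟨x₁, hx1⟩ := hx1
  obtain ⟨x₂, hx2⟩ := hx2
  obtain ⟨y₁, hy1⟩ := hy1
  obtain ⟨y₂, hy2⟩ := hy2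
  have hQ : (2 : ℝ) ≤ q := by exact_mod_cast hq2
  have hcast : ((q - 1 : ℕ) : ℝ) = q - 1 := by rw [Nat.cast_sub (by omega), Nat.cast_one]
  rw [key]
  refine lt_of_lt_of_le (lt_min (lt_of_lt_of_le (lt_min ?_ ?_) (hv_add _ _)) ?_) (hv_add _ _) <;>
    simp only [hneg, hv_mul, hpow]
  all_goals
    simp only [hx1, hx2, hy1, hy2, ← ha, ← WithTop.coe_nsmul, ← WithTop.coe_add,
      WithTop.coe_lt_coe, WithTop.coe_eq_one, WithTop.coe_pos, WithTop.coe_inj, nsmul_eq_mul,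
      Nat.cast_mul, Nat.cast_pow, hcast] at hvX₁ hvX₂ hvY₁ hvY₂ hu hu' ⊢
    clear hcast
    generalize (q : ℝ) = Q at *
    have hQ1 : 0 < Q - 1 := by linarith
    have hQ0 : 0 < Q := by linarith
    rw [lt_div_iff₀ (by linarith)] at hu'
    have ha3 : a * 3 < 1 := lt_of_le_of_lt (by gcongr; linarith) hu'
    have hy2_pos : 0 < y₂ := pos_of_mul_pos_right (hvY₂ ▸ hu) (by positivity)
    rw [div_lt_iff₀ (by positivity)]
  · have e : (Q * x₁ + y₂) * (Q * (Q - 1)) = Q ^ 2 * (1 - a) + y₂ * (Q * (Q - 1)) := by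
      linear_combination Q ^ 2 * hvX₁
    have : 0 < y₂ * (Q * (Q - 1)) := by positivity
    rw [e]
    nlinarith [mul_le_mul hQ hQ (by norm_num) hQ0.le]
  · have e : (Q * x₂ + y₁) * (Q * (Q - 1)) = Q * (1 - Q * a) + a := by
      linear_combination Q * hvX₂ + hvY₁
    rw [e]
    nlinarith [mul_lt_mul_of_pos_left hu' hQ1]
  · have e : (x₁ + Q * y₂) * (Q * (Q - 1)) = Q * (1 - a) + Q * y₂ * (Q * (Q - 1)) := by
      linear_combination Q * hvX₁
    have : 0 < Q * y₂ * (Q * (Q - 1)) := by positivity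
    rw [e]
    nlinarith
end

section
/- (Core of the claim that the space W₂ ⊂ X(π²) is a disjoint union of (q−1) annuli.) Suppose u, X₂, Y₂ ∈ K satisfy: 0 < v(u) < 1/(q+1), [π]_u([π]_u(X₂)) = [π]_u([π]_u(Y₂)) = 0, μ₂(X₂,Y₂) = π₂, and the valuation conditions v(X₁) = (1−v(u))/(q−1), v(X₂) = v(u)/(q(q−1)), v(Y₁) = v(u)/(q(q−1)), v(Y₂) = v(u)/(q³(q−1)), where X₁ = [π]_u(X₂) and Y₁ = [π]_u(Y₂). Then there exists ζ ∈ K with ζ^{q−1} = 1 such that v(X₂ − ζ Y₁) > v(X₂) = v(u)/(q(q−1)). -/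
/-- If a monic split polynomial takes a value of positive valuation at `t`, then `t` is congruent
to one of its roots. -/
theorem exists_root_addValuation_sub_pos {K : Type*} [Field K] (v : AddValuation K (WithTop ℝ))
    {P : Polynomial K} (hP : P.Splits) (hm : P.Monic) {t : K} (ht : 0 < v (P.eval t)) :
    ∃ r ∈ P.roots, 0 < v (t - r) := by
  by_contra! h
  have key : ∀ m : Multiset K, (∀ r ∈ m, v (t - r) ≤ 0) →
      v ((m.map fun r => t - r).prod) ≤ 0 := by
    intro m
    induction m using Multiset.induction_on with
    | empty => simp
    | cons a m ih =>
      intro hr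
      rw [Multiset.map_cons, Multiset.prod_cons, v.map_mul]
      exact add_nonpos (hr a (by simp)) (ih fun r hrm => hr r (by simp [hrm]))
  refine absurd ht (not_lt.mpr ?_)
  rw [hP.eval_eq_prod_roots_of_monic hm]
  exact key _ h

/-- If `x ^ (n + 1) * y - x * y ^ (n + 1)` has valuation greater than `(n + 2) • v y`, then `x` is
congruent to `ζ * y` for some `n`-th root of unity `ζ`, provided `v x = v y`. -/
theorem exists_rootOfUnity_addValuation_sub_mul {K : Type*} [Field K] [IsAlgClosed K]
    (v : AddValuation K (WithTop ℝ)) {n : ℕ} (hn : n ≠ 0) {x y : K} {a : ℝ}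
    (hx : v x = a) (hy : v y = a)
    (h : (((n + 2) * a : ℝ) : WithTop ℝ) < v (x ^ (n + 1) * y - x * y ^ (n + 1))) :
    ∃ ζ : K, ζ ^ n = 1 ∧ v x < v (x - ζ * y) := by
  have hy0 : y ≠ 0 := by
    rintro rfl
    simp at hy
  have hD : x ^ (n + 1) * y - x * y ^ (n + 1) = ((x / y) ^ n - 1) * (y ^ n * x * y) := by
    rw [div_pow]
    field_simp
    ring
  have hpos : 0 < v ((x / y) ^ n - 1) := by
    by_contra! hle
    refine absurd h (not_lt.mpr ?_)
    rw [hD, v.map_mul, v.map_mul, v.map_mul, v.map_pow, hx, hy]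
    refine (add_le_add_left hle _).trans (le_of_eq ?_)
    rw [zero_add, ← WithTop.coe_nsmul, ← WithTop.coe_add, ← WithTop.coe_add, nsmul_eq_mul]
    congr 1
    ring
  obtain ⟨ζ, hζ, hlt⟩ := exists_root_addValuation_sub_pos v (IsAlgClosed.splits _)
    (Polynomial.monic_X_pow_sub_C (1 : K) hn) (t := x / y) (by simpa using hpos)
  refine ⟨ζ, ?_, ?_⟩
  · have := Polynomial.isRoot_of_mem_roots hζ
    simpa [Polynomial.IsRoot, sub_eq_zero] using this
  · have : x - ζ * y = (x / y - ζ) * y := by field_simp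
    rw [this, v.map_mul, hx, hy]
    have := WithTop.add_lt_add_right (WithTop.coe_ne_top (a := a)) hlt
    simpa using this

/-- A value whose positive multiple is finite is finite. -/
theorem WithTop.exists_coe_of_nsmul_eq_coe {m : ℕ} (hm : m ≠ 0) {x : WithTop ℝ} {s : ℝ}
    (h : m • x = s) : ∃ a : ℝ, x = a ∧ m * a = s := by
  induction x using WithTop.recTopCoe with
  | top =>
    obtain ⟨k, rfl⟩ := Nat.exists_eq_succ_of_ne_zero hm
    rw [succ_nsmul, WithTop.add_top] at h
    exact absurd h (WithTop.top_ne_coe)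
  | coe a =>
    refine ⟨a, rfl, ?_⟩
    rw [← WithTop.coe_nsmul, WithTop.coe_inj, nsmul_eq_mul] at h
    exact h

/-- A lower bound for the valuation of a solution of `π * π₂ - π₂ ^ (n + 1) = π₁`. -/
theorem lt_addValuation_of_mul_sub_pow {K : Type*} [Field K] (v : AddValuation K (WithTop ℝ))
    {n : ℕ} (hn : n ≠ 0) {π π₁ π₂ : K} (hπ : v π = 1) (hπ₁ : π₁ ^ n = π)
    (hπ₂ : π * π₂ - π₂ ^ (n + 1) = π₁) {r : ℝ} (hr : n * (n + 1) * r < 1) :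
    (r : WithTop ℝ) < v π₂ := by
  by_contra! hle
  have hn1 : (1 : ℝ) ≤ n := by exact_mod_cast Nat.one_le_iff_ne_zero.mpr hn
  obtain ⟨w, hw⟩ := WithTop.ne_top_iff_exists.mp (ne_top_of_le_ne_top WithTop.coe_ne_top hle)
  rw [← hw, WithTop.coe_le_coe] at hle
  obtain ⟨b, hb, hnb⟩ := WithTop.exists_coe_of_nsmul_eq_coe (s := 1) hn
    (show n • v π₁ = ((1 : ℝ) : WithTop ℝ) by rw [← v.map_pow, hπ₁, hπ]; rfl)
  have hwr : n * (n + 1) * w < 1 :=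
    lt_of_le_of_lt (mul_le_mul_of_nonneg_left hle (by positivity)) hr
  have hpow : v (π₂ ^ (n + 1)) = (((n + 1) * w : ℝ) : WithTop ℝ) := by
    rw [v.map_pow, ← hw, ← WithTop.coe_nsmul, nsmul_eq_mul]
    push_cast
    rfl
  have hmul : v (π * π₂) = ((1 + w : ℝ) : WithTop ℝ) := by
    rw [v.map_mul, hπ, ← hw]
    rfl
  have h1 : (n + 1) * w < 1 + w := by nlinarith
  have h2 : (n + 1) * w < b := by
    by_contra! hb'
    nlinarith
  have : v (π₂ ^ (n + 1)) < v (π * π₂ - π₁) := by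
    refine lt_of_lt_of_le (lt_min ?_ ?_) (v.map_sub _ _)
    · rw [hpow, hmul]
      exact_mod_cast h1
    · rw [hpow, hb]
      exact_mod_cast h2
  rw [← hπ₂, sub_sub_cancel] at this
  exact lt_irrefl _ this


/-- on the space W₂ ⊂ X(π²), X₂ is congruent to ζ·Y₁ for some
(q−1)-st root of unity ζ, modulo terms of valuation strictly greater than
v(X₂) = v(u)/(q(q−1)). Valuation conditions are encoded denominator-free using
ℕ-scalar multiples. -/
theorem stmt_17 (p f q : ℕ) (hp : p.Prime) (hf : 0 < f) (hq : q = p ^ f)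
    (K : Type*) [Field K] [IsAlgClosed K] [CharP K p]
    (v : K → WithTop ℝ)
    (hv_top : ∀ x : K, v x = ⊤ ↔ x = 0)
    (hv_mul : ∀ x y : K, v (x * y) = v x + v y)
    (hv_add : ∀ x y : K, min (v x) (v y) ≤ v (x + y))
    (π : K) (hπ : v π = 1)
    (π₁ : K) (hπ₁ : π₁ ^ (q - 1) = π)
    (π₂ : K) (hπ₂ : π * π₂ - π₂ ^ q = π₁)
    (u X₂ Y₂ X₁ Y₁ : K)
    (hX₁ : X₁ = X₂ ^ q ^ 2 + u * X₂ ^ q + π * X₂)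
    (hY₁ : Y₁ = Y₂ ^ q ^ 2 + u * Y₂ ^ q + π * Y₂)
    (htorX : X₁ ^ q ^ 2 + u * X₁ ^ q + π * X₁ = 0)
    (htorY : Y₁ ^ q ^ 2 + u * Y₁ ^ q + π * Y₁ = 0)
    (hμ₂ : X₁ * Y₂ ^ q - X₁ ^ q * Y₂ - X₂ ^ q * Y₁ + X₂ * Y₁ ^ q = π₂)
    (hu : 0 < v u) (hu' : v u < ((1 / ((q : ℝ) + 1) : ℝ) : WithTop ℝ))
    (hvX₁ : (q - 1) • v X₁ + v u = 1)
    (hvX₂ : (q * (q - 1)) • v X₂ = v u)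
    (hvY₁ : (q * (q - 1)) • v Y₁ = v u)
    (hvY₂ : (q ^ 3 * (q - 1)) • v Y₂ = v u) :
    ∃ ζ : K, ζ ^ (q - 1) = 1 ∧ v X₂ < v (X₂ - ζ * Y₁) := by
  obtain ⟨n, rfl⟩ : ∃ n, q = n + 1 :=
    Nat.exists_eq_succ_of_ne_zero (hq ▸ pow_ne_zero _ hp.ne_zero)
  have hn : n ≠ 0 := by
    rintro rfl
    exact absurd hq.symm (Nat.one_lt_pow hf.ne' hp.one_lt).ne'
  rw [Nat.add_sub_cancel] at *
  have hv1 : v 1 = 0 := by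
    obtain ⟨e, he⟩ := WithTop.ne_top_iff_exists.mp (mt (hv_top 1).mp one_ne_zero)
    have h := hv_mul 1 1
    rw [mul_one, ← he, ← WithTop.coe_add, WithTop.coe_inj] at h
    rw [← he, left_eq_add.mp h]
    rfl
  obtain ⟨w, hw⟩ : ∃ w : AddValuation K (WithTop ℝ), ∀ x, w x = v x :=
    ⟨AddValuation.of v ((hv_top 0).mpr rfl) hv1 hv_add hv_mul, fun _ => rfl⟩
  simp only [← hw] at *
  have hn1 : (1 : ℝ) ≤ n := by exact_mod_cast Nat.one_le_iff_ne_zero.mpr hn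
  obtain ⟨s, hs⟩ := WithTop.ne_top_iff_exists.mp (ne_top_of_lt hu')
  rw [← hs] at hu hu' hvX₁ hvX₂ hvY₁ hvY₂
  rw [WithTop.coe_lt_coe, lt_div_iff₀ (by positivity)] at hu'
  replace hu : 0 < s := by exact_mod_cast hu
  push_cast at hu'
  obtain ⟨b, hb, hbs⟩ := WithTop.exists_coe_of_nsmul_eq_coe (x := w X₁) (s := 1 - s) hn (by
    refine WithTop.add_right_cancel (WithTop.coe_ne_top (a := s)) ?_
    rw [hvX₁, ← WithTop.coe_add, sub_add_cancel]
    rfl)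
  obtain ⟨a, ha, has⟩ := WithTop.exists_coe_of_nsmul_eq_coe (by positivity) hvX₂
  obtain ⟨a', ha', has'⟩ := WithTop.exists_coe_of_nsmul_eq_coe (by positivity) hvY₁
  obtain ⟨c, hc, hcs⟩ := WithTop.exists_coe_of_nsmul_eq_coe (by positivity) hvY₂
  push_cast at has has' hcs
  obtain rfl : a' = a :=
    mul_left_cancel₀ (show ((n : ℝ) + 1) * n ≠ 0 by positivity) (has'.trans has.symm)
  have hr : (n : ℝ) * (n + 1) * ((n + 2) * a') < 1 := by linear_combination hu' + (n + 2) * has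
  have hc0 : 0 < c := pos_of_mul_pos_right (hcs ▸ hu) (by positivity)
  have hns : (n + 1) * (n * b) ≥ (1 : ℝ) := by
    rw [hbs]
    nlinarith
  have hb0 : 0 < b := by
    by_contra! h
    nlinarith [mul_nonneg (show (0 : ℝ) ≤ (n + 1) * n by positivity) (neg_nonneg.mpr h)]
  have hab : (n + 2) * a' < b := by
    by_contra! h
    nlinarith [mul_le_mul_of_nonneg_left h (show (0 : ℝ) ≤ (n + 1) * n by positivity)]
  refine exists_rootOfUnity_addValuation_sub_mul w hn ha ha' ?_
  have hD : X₂ ^ (n + 1) * Y₁ - X₂ * Y₁ ^ (n + 1) =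
      X₁ * Y₂ ^ (n + 1) - X₁ ^ (n + 1) * Y₂ - π₂ := by
    rw [← hμ₂]
    ring
  rw [hD]
  refine lt_of_lt_of_le (lt_min (lt_of_lt_of_le (lt_min ?_ ?_) (w.map_sub _ _))
    (lt_addValuation_of_mul_sub_pow w hn hπ hπ₁ hπ₂ hr)) (w.map_sub _ _)
  · rw [w.map_mul, w.map_pow, hb, hc, ← WithTop.coe_nsmul, ← WithTop.coe_add, WithTop.coe_lt_coe,
      nsmul_eq_mul]
    have : 0 < ((n + 1 : ℕ) : ℝ) * c := by positivity
    linarith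
  · rw [w.map_mul, w.map_pow, hb, hc, ← WithTop.coe_nsmul, ← WithTop.coe_add, WithTop.coe_lt_coe,
      nsmul_eq_mul]
    push_cast
    nlinarith
end

section
/- (Core of the claim that the spaces U₂ and U₃ ⊂ X(π²) are disjoint unions of (q−1) annuli.) Suppose u, X₂, Y₂ ∈ K satisfy: 1/(q+1) < v(u) < q/(q+1) with v(u) ≠ 1/2, [π]_u([π]_u(X₂)) = [π]_u([π]_u(Y₂)) = 0, μ₂(X₂,Y₂) = π₂, and the valuation conditions v(X₁) = v(Y₁) = v(u)/(q(q−1)) and v(X₂) = v(Y₂) = v(u)/(q³(q−1)), where X₁ = [π]_u(X₂) and Y₁ = [π]_u(Y₂). Then a = X₂/Y₂ satisfies v(a) = 0 and v(a^q − a) = 1/(q²(q−1)) − (q+1)·v(Y₂) = 1/(q²(q−1)) − (q+1)v(u)/(q³(q−1)) > 0; in particular the residue of a lies in F_q^×. -/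
/-- If `m ^ q - m * R = c` and `R` has large valuation compared with `c`, then `m ^ q`
dominates, so that the valuation of `m` is the one of `c` divided by `q`. -/
theorem AddValuation.eq_div_of_pow_sub_mul_eq {K : Type*} [Field K]
    (w : AddValuation K (WithTop ℝ)) {q : ℕ} (hq : 2 ≤ q) {m R c : K} {γ : ℝ}
    (hc : w c = (γ : WithTop ℝ))
    (hR : ((((q : ℝ) - 1) * γ / q : ℝ) : WithTop ℝ) < w R)
    (h : m ^ q - m * R = c) : w m = ((γ / q : ℝ) : WithTop ℝ) := by
  have hq2 : (2 : ℝ) ≤ q := by exact_mod_cast hq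
  have hq0 : (0 : ℝ) < q := by linarith
  have hm : m ≠ 0 := by
    rintro rfl
    rw [zero_pow (by omega), zero_mul, sub_zero] at h
    rw [← h, w.map_zero] at hc
    exact WithTop.top_ne_coe hc
  obtain ⟨μ, hμ⟩ := WithTop.ne_top_iff_exists.1 (w.ne_top_iff.2 hm)
  have hpow : w (m ^ q) = ((q * μ : ℝ) : WithTop ℝ) := by
    rw [w.map_pow, ← hμ, ← WithTop.coe_nsmul, nsmul_eq_mul]
  rw [← hμ, WithTop.coe_eq_coe]
  have hmR : ((μ + ((q : ℝ) - 1) * γ / q : ℝ) : WithTop ℝ) < w (m * R) := by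
    rw [w.map_mul, ← hμ, WithTop.coe_add]
    exact WithTop.add_lt_add_left WithTop.coe_ne_top hR
  have hsplit : ((q : ℝ) - 1) * γ / q = γ - γ / q := by field_simp
  rw [hsplit] at hmR
  have hγ : q * (γ / q) = γ := by field_simp
  rcases lt_or_ge (γ / q) μ with hlt | hge
  · exfalso
    have h1 : w c < w (m ^ q) := by
      rw [hc, hpow, WithTop.coe_lt_coe]
      nlinarith
    have h2 : w c < w (m * R) := by
      rw [hc]
      refine lt_trans (WithTop.coe_lt_coe.2 ?_) hmR
      linarith
    have h3 := w.map_lt_add h1 (h2.trans_eq (w.map_neg _).symm)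
    rw [← sub_eq_add_neg, h] at h3
    exact lt_irrefl _ h3
  · have h1 : w (m ^ q) < w (m * R) := by
      rw [hpow]
      refine lt_of_le_of_lt (WithTop.coe_le_coe.2 ?_) hmR
      nlinarith
    have h2 : w c = w (m ^ q) := by
      rw [← h, sub_eq_add_neg]
      exact w.map_add_eq_of_lt_left (by rwa [w.map_neg])
    rw [hc, hpow, WithTop.coe_eq_coe] at h2
    rw [h2]
    field_simp

/-- In an algebraically closed valued field, an element of valuation zero whose `n`-th power
is residually `1` is residually an `n`-th root of unity. -/
theorem AddValuation.exists_pow_eq_one_of_pos {K : Type*} [Field K] [IsAlgClosed K]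
    (w : AddValuation K (WithTop ℝ)) {n : ℕ} (hn : n ≠ 0) {a : K}
    (ha : 0 < w (a ^ n - 1)) : ∃ ζ : K, ζ ^ n = 1 ∧ 0 < w (a - ζ) := by
  by_contra! hcon
  have hmonic : (Polynomial.X ^ n - 1 : Polynomial K).Monic := by
    simpa using Polynomial.monic_X_pow_sub_C (1 : K) hn
  have heval := (IsAlgClosed.splits (Polynomial.X ^ n - 1 : Polynomial K)).eval_eq_prod_roots a
  rw [hmonic.leadingCoeff, one_mul] at heval
  simp only [Polynomial.eval_sub, Polynomial.eval_pow, Polynomial.eval_X,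
    Polynomial.eval_one] at heval
  have hprod : ∀ s : Multiset K, (∀ ζ ∈ s, ζ ^ n = 1) →
      w (s.map fun ζ => a - ζ).prod ≤ 0 := by
    intro s
    induction s using Multiset.induction_on with
    | empty => simp
    | cons ζ s ih =>
      intro hs
      rw [Multiset.map_cons, Multiset.prod_cons, w.map_mul]
      exact add_nonpos (hcon ζ (hs ζ (Multiset.mem_cons_self ζ s)))
        (ih fun ξ hξ => hs ξ (Multiset.mem_cons_of_mem hξ))
  rw [heval] at ha
  refine absurd ha (not_lt.2 (hprod _ fun ζ hζ => ?_))
  have := (Polynomial.mem_roots'.1 hζ).2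
  simpa [Polynomial.IsRoot, sub_eq_zero] using this

/-- The level-2 Moore determinant in the coordinates `a = X₂ / Y₂` and `Y = Y₂`. -/
theorem moore_determinant_eq {K : Type*} [Field K] (p f : ℕ) [Fact p.Prime] [CharP K p]
    {q : ℕ} (hq : q = p ^ f) (hq1 : 1 ≤ q) (π u a Y d : K) (hd : a ^ q = a + d) :
    ((a * Y) ^ q ^ 2 + u * (a * Y) ^ q + π * (a * Y)) * Y ^ q
      - ((a * Y) ^ q ^ 2 + u * (a * Y) ^ q + π * (a * Y)) ^ q * Y
      - (a * Y) ^ q * (Y ^ q ^ 2 + u * Y ^ q + π * Y)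
      + (a * Y) * (Y ^ q ^ 2 + u * Y ^ q + π * Y) ^ q
    = (Y ^ (q + 1) * d) ^ q - (Y ^ (q + 1) * d) *
      (π + (π ^ q + (u ^ q * Y ^ (q ^ 2 - q) * (d ^ (q - 1) + 1)
        + Y ^ (q ^ 3 - q) * (d ^ (q ^ 2 - 1) + d ^ (q - 1) + 1)))) := by
  have hadd : ∀ x y : K, (x + y) ^ q = x ^ q + y ^ q := fun x y => by
    rw [hq]; exact add_pow_char_pow x y p f
  have hY2 : Y ^ q ^ 2 = Y ^ (q ^ 2 - q) * Y ^ q := by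
    rw [← pow_add, Nat.sub_add_cancel (by nlinarith)]
  have hY3 : Y ^ q ^ 3 = Y ^ (q ^ 3 - q) * Y ^ q := by
    rw [← pow_add, Nat.sub_add_cancel (Nat.le_self_pow (by omega) q)]
  have hd1 : d ^ q = d ^ (q - 1) * d := by
    rw [← pow_succ, Nat.sub_add_cancel hq1]
  have hd2 : d ^ q ^ 2 = d ^ (q ^ 2 - 1) * d := by
    rw [← pow_succ, Nat.sub_add_cancel (Nat.one_le_pow _ _ hq1)]
  have hsq : ∀ x : K, (x ^ q) ^ q = x ^ q ^ 2 := fun x => by rw [← pow_mul, sq]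
  have hcu : ∀ x : K, (x ^ q ^ 2) ^ q = x ^ q ^ 3 := fun x => by
    rw [← pow_mul, pow_succ q 2]
  have ha2 : a ^ q ^ 2 = a + d + d ^ q := by rw [← hsq, hd, hadd, hd]
  have ha3 : a ^ q ^ 3 = a + d + d ^ q + d ^ q ^ 2 := by
    rw [← hcu, ha2, hadd, hadd, hd, hsq]
  have hm : (Y ^ (q + 1) * d) ^ q = Y ^ q ^ 2 * Y ^ q * d ^ q := by
    rw [mul_pow, pow_succ, mul_pow, hsq]
  rw [hm]
  simp only [hadd, mul_pow, hsq, hcu, ha2, hd, pow_succ Y q]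
  rw [hY3, hY2, hd2, hd1]
  ring


/-- on the spaces U₂ and U₃ ⊂ X(π²), a = X₂/Y₂ satisfies v(a) = 0 and
v(a^q − a) = 1/(q²(q−1)) − (q+1)·v(Y₂) = 1/(q²(q−1)) − (q+1)v(u)/(q³(q−1)) > 0
(the equalities encoded denominator-free as v(a^q−a) + (q+1)·v(Y₂) = 1/(q²(q−1))
and q³(q−1)·v(a^q−a) + (q+1)·v(u) = q); in particular the residue of a lies in F_q^×. -/
theorem stmt_19 (p f q : ℕ) (hp : p.Prime) (hf : 0 < f) (hq : q = p ^ f)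
    (K : Type*) [Field K] [IsAlgClosed K] [CharP K p]
    (v : K → WithTop ℝ)
    (hv_top : ∀ x : K, v x = ⊤ ↔ x = 0)
    (hv_mul : ∀ x y : K, v (x * y) = v x + v y)
    (hv_add : ∀ x y : K, min (v x) (v y) ≤ v (x + y))
    (π : K) (hπ : v π = 1)
    (π₁ : K) (hπ₁ : π₁ ^ (q - 1) = π)
    (π₂ : K) (hπ₂ : π * π₂ - π₂ ^ q = π₁)
    (u X₂ Y₂ X₁ Y₁ : K)
    (hX₁ : X₁ = X₂ ^ q ^ 2 + u * X₂ ^ q + π * X₂)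
    (hY₁ : Y₁ = Y₂ ^ q ^ 2 + u * Y₂ ^ q + π * Y₂)
    (htorX : X₁ ^ q ^ 2 + u * X₁ ^ q + π * X₁ = 0)
    (htorY : Y₁ ^ q ^ 2 + u * Y₁ ^ q + π * Y₁ = 0)
    (hμ₂ : X₁ * Y₂ ^ q - X₁ ^ q * Y₂ - X₂ ^ q * Y₁ + X₂ * Y₁ ^ q = π₂)
    (hu : ((1 / ((q : ℝ) + 1) : ℝ) : WithTop ℝ) < v u)
    (hu' : v u < (((q : ℝ) / ((q : ℝ) + 1) : ℝ) : WithTop ℝ))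
    (hu'' : v u ≠ ((1 / 2 : ℝ) : WithTop ℝ))
    (hvX₁ : (q * (q - 1)) • v X₁ = v u)
    (hvY₁ : (q * (q - 1)) • v Y₁ = v u)
    (hvX₂ : (q ^ 3 * (q - 1)) • v X₂ = v u)
    (hvY₂ : (q ^ 3 * (q - 1)) • v Y₂ = v u)
    (a : K) (ha : a = X₂ / Y₂) :
    v a = 0 ∧
    v (a ^ q - a) + (q + 1) • v Y₂
      = ((1 / ((q : ℝ) ^ 2 * ((q : ℝ) - 1)) : ℝ) : WithTop ℝ) ∧
    (q ^ 3 * (q - 1)) • v (a ^ q - a) + (q + 1) • v u = ((q : ℝ) : WithTop ℝ) ∧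
    0 < v (a ^ q - a) ∧
    ∃ ζ : K, ζ ^ (q - 1) = 1 ∧ 0 < v (a - ζ) := by
  have : Fact p.Prime := ⟨hp⟩
  have hq2 : 2 ≤ q := by
    rw [hq]
    exact hp.two_le.trans (Nat.le_self_pow hf.ne' p)
  have hqR : (2 : ℝ) ≤ q := by exact_mod_cast hq2
  have hq0 : (0 : ℝ) < q := by linarith
  have hq1 : (0 : ℝ) < (q : ℝ) - 1 := by linarith
  have hqsub : ((q - 1 : ℕ) : ℝ) = (q : ℝ) - 1 := by
    rw [Nat.cast_sub (by omega), Nat.cast_one]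
  have hv_one : v 1 = 0 := by
    obtain ⟨r, hr⟩ := WithTop.ne_top_iff_exists.1 (mt (hv_top 1).1 one_ne_zero)
    have h := hv_mul 1 1
    rw [mul_one, ← hr, ← WithTop.coe_add, WithTop.coe_eq_coe] at h
    rw [← hr, ← WithTop.coe_zero, WithTop.coe_eq_coe]
    linarith
  obtain ⟨w, hw⟩ : ∃ w : AddValuation K (WithTop ℝ), ∀ x, w x = v x :=
    ⟨AddValuation.of v ((hv_top 0).2 rfl) hv_one hv_add hv_mul, fun _ => rfl⟩
  simp only [← hw] at hπ hu hu' hvX₂ hvY₂ ⊢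
  have hpow : ∀ {x : K} {r : ℝ} (n : ℕ), w x = (r : WithTop ℝ) →
      w (x ^ n) = ((n * r : ℝ) : WithTop ℝ) := fun n h => by
    rw [w.map_pow, h, ← WithTop.coe_nsmul, nsmul_eq_mul]
  -- real representatives of the valuations of `u`, `Y₂`, `X₂`
  obtain ⟨t, ht⟩ := WithTop.ne_top_iff_exists.1 (ne_top_of_lt hu')
  rw [← ht, WithTop.coe_lt_coe] at hu hu'
  rw [div_lt_iff₀ (by linarith)] at hu
  rw [lt_div_iff₀ (by linarith)] at hu'
  have hN : q ^ 3 * (q - 1) ≠ 0 := by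
    have : q - 1 ≠ 0 := by omega
    positivity
  have hreal : ∀ x : K, (q ^ 3 * (q - 1)) • w x = w u →
      w x = ((t / ((q : ℝ) ^ 3 * ((q : ℝ) - 1)) : ℝ) : WithTop ℝ) := by
    intro x hx
    have hx0 : w x ≠ ⊤ := by
      intro h
      have hxz : w (x ^ (q ^ 3 * (q - 1))) = w u := by rw [w.map_pow, hx]
      rw [w.top_iff.1 h, zero_pow hN, w.map_zero, ← ht] at hxz
      exact WithTop.top_ne_coe hxz
    obtain ⟨r, hr⟩ := WithTop.ne_top_iff_exists.1 hx0
    rw [← hr, ← ht, ← WithTop.coe_nsmul, WithTop.coe_eq_coe, nsmul_eq_mul] at hx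
    push_cast [hqsub] at hx
    rw [← hr, WithTop.coe_eq_coe, eq_div_iff (by positivity)]
    linarith
  have hX := hreal X₂ hvX₂
  have hY := hreal Y₂ hvY₂
  obtain ⟨y, hy⟩ : ∃ y : ℝ, y = t / ((q : ℝ) ^ 3 * ((q : ℝ) - 1)) := ⟨_, rfl⟩
  rw [← hy] at hX hY
  have hyt : (q : ℝ) ^ 3 * ((q : ℝ) - 1) * y = t := by
    rw [hy]
    field_simp
  have hY0 : Y₂ ≠ 0 := w.ne_top_iff.1 (by rw [hY]; exact WithTop.coe_ne_top)
  have hXa : X₂ = a * Y₂ := by rw [ha]; field_simp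
  have hwa : w a = 0 := by
    have h : w X₂ = w a + w Y₂ := by rw [hXa, w.map_mul]
    rw [hX, hY] at h
    have ha0 : w a ≠ ⊤ := by
      intro h0
      rw [h0, top_add] at h
      exact WithTop.coe_ne_top h
    obtain ⟨r, hr⟩ := WithTop.ne_top_iff_exists.1 ha0
    rw [← hr, ← WithTop.coe_add, WithTop.coe_eq_coe] at h
    rw [← hr, ← WithTop.coe_zero, WithTop.coe_eq_coe]
    linarith
  obtain ⟨d, hd⟩ : ∃ d : K, d = a ^ q - a := ⟨_, rfl⟩
  rw [← hd]
  have hd0 : 0 ≤ w d := by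
    rw [hd]
    refine w.map_le_sub ?_ hwa.ge
    rw [w.map_pow, hwa, smul_zero]
  have hdn : ∀ n : ℕ, 0 ≤ w (d ^ n) := fun n => by
    rw [w.map_pow]
    exact nsmul_nonneg hd0 n
  have h_one : (0 : WithTop ℝ) ≤ w 1 := w.map_one.ge
  -- valuation of `π₂`
  have hwπ₁ : w π₁ = ((1 / ((q : ℝ) - 1) : ℝ) : WithTop ℝ) := by
    have h0 : w π₁ ≠ ⊤ := by
      intro h
      rw [w.top_iff.1 h, zero_pow (by omega)] at hπ₁
      rw [← hπ₁, w.map_zero] at hπ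
      exact WithTop.top_ne_coe hπ
    obtain ⟨r, hr⟩ := WithTop.ne_top_iff_exists.1 h0
    have h := hpow (q - 1) hr.symm
    rw [hπ₁, hπ, ← WithTop.coe_one, WithTop.coe_eq_coe, hqsub] at h
    rw [← hr, WithTop.coe_eq_coe, eq_div_iff hq1.ne']
    linarith
  have hwπ₂ : w π₂ = ((1 / ((q : ℝ) - 1) / q : ℝ) : WithTop ℝ) := by
    refine w.eq_div_of_pow_sub_mul_eq hq2 (R := π) (c := -π₁) (by rw [w.map_neg, hwπ₁]) ?_
      (by rw [← hπ₂]; ring)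
    rw [hπ, ← WithTop.coe_one, WithTop.coe_lt_coe, mul_one_div_cancel hq1.ne',
      div_lt_one hq0]
    linarith
  -- the determinant, as a polynomial in `Y₂ ^ (q + 1) * (a ^ q - a)`
  have hdet := moore_determinant_eq p f hq (by omega) π u a Y₂ d (by rw [hd]; ring)
  rw [← hXa, ← hX₁, ← hY₁, hμ₂] at hdet
  have hgamma : ((q : ℝ) - 1) * (1 / ((q : ℝ) - 1) / q) / q = 1 / (q : ℝ) ^ 2 := by
    field_simp
  have hsmall : 1 / (q : ℝ) ^ 2 < 1 := by
    rw [div_lt_one (by positivity)]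
    nlinarith
  have hwm : w (Y₂ ^ (q + 1) * d) = ((1 / ((q : ℝ) - 1) / q / q : ℝ) : WithTop ℝ) := by
    refine w.eq_div_of_pow_sub_mul_eq hq2 hwπ₂ ?_ hdet.symm
    rw [hgamma]
    refine w.map_lt_add ?_ (w.map_lt_add ?_ (w.map_lt_add ?_ ?_))
    · rw [hπ, ← WithTop.coe_one, WithTop.coe_lt_coe]
      exact hsmall
    · rw [hpow q (r := 1) hπ, WithTop.coe_lt_coe]
      linarith
    · rw [w.map_mul]
      refine lt_of_lt_of_le ?_ (le_add_of_nonneg_right (w.map_le_add (hdn _) h_one))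
      rw [w.map_mul, hpow q ht.symm, hpow (q ^ 2 - q) hY, ← WithTop.coe_add,
        WithTop.coe_lt_coe, Nat.cast_sub (by nlinarith), div_lt_iff₀ (by positivity)]
      push_cast
      have : (q * t + ((q : ℝ) ^ 2 - q) * y) * q ^ 2 = t * (q + 1) * (q ^ 2 - q + 1) := by
        rw [← hyt]
        ring
      rw [this]
      nlinarith
    · rw [w.map_mul]
      refine lt_of_lt_of_le ?_ (le_add_of_nonneg_right
        (w.map_le_add (w.map_le_add (hdn _) (hdn _)) h_one))
      rw [hpow (q ^ 3 - q) hY, WithTop.coe_lt_coe,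
        Nat.cast_sub (Nat.le_self_pow (by omega) q), div_lt_iff₀ (by positivity)]
      push_cast
      have : ((q : ℝ) ^ 3 - q) * y * q ^ 2 = t * (q + 1) := by
        rw [← hyt]
        ring
      rw [this]
      linarith
  rw [w.map_mul, w.map_pow] at hwm
  have hwd : w d ≠ ⊤ := by
    intro h
    rw [h, add_top] at hwm
    exact WithTop.top_ne_coe hwm
  obtain ⟨δ, hδ⟩ := WithTop.ne_top_iff_exists.1 hwd
  rw [← hδ, hY, ← WithTop.coe_nsmul, ← WithTop.coe_add, WithTop.coe_eq_coe, nsmul_eq_mul,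
    div_div, div_div] at hwm
  push_cast at hwm
  have hδt : (q : ℝ) ^ 3 * ((q : ℝ) - 1) * δ + (q + 1) * t = q := by
    have : (q : ℝ) ^ 3 * ((q : ℝ) - 1) * ((q + 1) * y + δ) = q := by
      rw [hwm]
      field_simp
    linear_combination this - (q + 1) * hyt
  have hδ0 : 0 < δ := by
    have h3 : (0 : ℝ) < (q : ℝ) ^ 3 * ((q : ℝ) - 1) := by positivity
    refine pos_of_mul_pos_right (a := (q : ℝ) ^ 3 * ((q : ℝ) - 1)) ?_ h3.le
    linarith
  have hpos : 0 < w d := by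
    rw [← hδ, ← WithTop.coe_zero, WithTop.coe_lt_coe]
    exact hδ0
  refine ⟨hwa, ?_, ?_, hpos, ?_⟩
  · rw [← hδ, hY, ← WithTop.coe_nsmul, ← WithTop.coe_add, WithTop.coe_eq_coe, nsmul_eq_mul]
    push_cast
    rw [add_comm, hwm]
    ring
  · rw [← hδ, ← ht, ← WithTop.coe_nsmul, ← WithTop.coe_nsmul, ← WithTop.coe_add,
      WithTop.coe_eq_coe, nsmul_eq_mul, nsmul_eq_mul]
    push_cast [hqsub]
    exact hδt
  · refine w.exists_pow_eq_one_of_pos (by omega) ?_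
    have : d = a * (a ^ (q - 1) - 1) := by
      rw [hd, mul_sub, ← pow_succ', Nat.sub_add_cancel (by omega), mul_one]
    rwa [this, w.map_mul, hwa, zero_add] at hpos
end
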